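/- arXiv:0904.1053 — 4 statements merged into one kernel-verified Lean document; each statement's English description precedes it below -/
import Mathlib

section
/- Let φ(x) := ψ(x) + 1/(2x) - log x, where ψ = Γ'/Γ is the digamma function. If α and β are positive real numbers with αβ = 1, then √α · { (γ - log(2πα))/(2α) + Σ_{n=1}^∞ φ(nα) } = √β · { (γ - log(2πβ))/(2β) + Σ_{n=1}^∞ φ(nβ) }, where γ is Euler's constant; in particular both series converge. -/
open Real MeasureTheory Filter

/-- The digamma function `ψ = Γ'/Γ`. -/
noncomputable def digamma (x : ℝ) : ℝ := deriv Real.Gamma x / Real.Gamma x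

/-- `φ(x) := ψ(x) + 1/(2x) - log x`. -/
noncomputable def phi (x : ℝ) : ℝ := digamma x + 1 / (2 * x) - Real.log x

open Topology

theorem differentiableAt_Gamma_of_pos {x : ℝ} (hx : 0 < x) : DifferentiableAt ℝ Gamma x :=
  Real.differentiableAt_Gamma fun m => by
    have : (0 : ℝ) ≤ m := m.cast_nonneg
    linarith

theorem hasDerivAt_log_Gamma {x : ℝ} (hx : 0 < x) :
    HasDerivAt (log ∘ Gamma) (digamma x) x :=
  (differentiableAt_Gamma_of_pos hx).hasDerivAt.log (Gamma_pos_of_pos hx).ne'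

theorem log_Gamma_add_one {x : ℝ} (hx : 0 < x) :
    log (Gamma (x + 1)) = log (Gamma x) + log x := by
  rw [Gamma_add_one hx.ne', log_mul hx.ne' (Gamma_pos_of_pos hx).ne', add_comm]

theorem digamma_add_one {x : ℝ} (hx : 0 < x) : digamma (x + 1) = digamma x + 1 / x := by
  have h1 : HasDerivAt (fun y => log (Gamma (y + 1))) (digamma (x + 1)) x :=
    HasDerivAt.comp_add_const x 1 (hasDerivAt_log_Gamma (by positivity))
  have h2 : HasDerivAt (fun y => log (Gamma y) + log y) (digamma x + x⁻¹) x :=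
    (hasDerivAt_log_Gamma hx).add (hasDerivAt_log hx.ne')
  rw [one_div]
  refine h1.unique (h2.congr_of_eventuallyEq ?_)
  filter_upwards [lt_mem_nhds hx] with y hy using log_Gamma_add_one hy

theorem digamma_le_log {x : ℝ} (hx : 0 < x) : digamma x ≤ log x := by
  have h := convexOn_log_Gamma.le_slope_of_hasDerivAt hx (by positivity : (0 : ℝ) < x + 1)
    (by linarith) (hasDerivAt_log_Gamma hx)
  simpa [slope_def_field, log_Gamma_add_one hx] using h

theorem log_sub_inv_le_digamma {x : ℝ} (hx : 0 < x) : log x - 1 / x ≤ digamma x := by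
  have h := convexOn_log_Gamma.slope_le_of_hasDerivAt hx (by positivity : (0 : ℝ) < x + 1)
    (by linarith) (hasDerivAt_log_Gamma (by positivity))
  rw [digamma_add_one hx] at h
  simp [slope_def_field, log_Gamma_add_one hx] at h
  rw [one_div]
  linarith

theorem tendsto_phi_add_nat (x : ℝ) (hx : 0 < x) :
    Tendsto (fun n : ℕ => phi (x + n)) atTop (𝓝 0) := by
  have h : Tendsto (fun n : ℕ => 1 / (x + n)) atTop (𝓝 0) := by
    simp_rw [one_div]
    exact (tendsto_atTop_add_const_left _ x tendsto_natCast_atTop_atTop).inv_tendsto_atTop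
  refine squeeze_zero_norm (fun n => ?_) h
  have hn : 0 < x + n := by positivity
  have h1 := digamma_le_log hn
  have h2 := log_sub_inv_le_digamma hn
  have h3 : 1 / (2 * (x + n)) = 1 / (x + n) / 2 := by field_simp
  have h4 : 0 < 1 / (x + n) := by positivity
  rw [phi, norm_eq_abs, abs_le, h3]
  constructor <;> linarith

theorem nonneg_of_le_of_tendsto {f : ℝ → ℝ} (hf : ∀ x, 0 < x → f (x + 1) ≤ f x)
    (hlim : ∀ x, 0 < x → Tendsto (fun n : ℕ => f (x + n)) atTop (𝓝 0)) {x : ℝ} (hx : 0 < x) :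
    0 ≤ f x := by
  have hanti : Antitone fun n : ℕ => f (x + n) := antitone_nat_of_succ_le fun n => by
    have := hf (x + n) (by positivity)
    rwa [add_assoc, ← Nat.cast_add_one] at this
  simpa using hanti.le_of_tendsto (hlim x hx) 0

theorem phi_sub_phi_add_one {x : ℝ} (hx : 0 < x) :
    phi x - phi (x + 1) = log (1 + 1 / x) - (1 / x + 1 / (x + 1)) / 2 := by
  have h : 1 + 1 / x = (x + 1) / x := by field_simp
  rw [phi, phi, digamma_add_one hx, h, log_div (by positivity) hx.ne']
  field_simp
  ring

theorem log_one_add_inv_le {x : ℝ} (hx : 0 < x) :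
    log (1 + 1 / x) ≤ (1 / x + 1 / (x + 1)) / 2 := by
  have hp : 0 < 1 + 1 / x := by positivity
  have h := self_le_sinh_iff.2 (log_nonneg (x := 1 + 1 / x) (by simp [hx.le]))
  rw [sinh_log hp] at h
  refine h.trans_eq ?_
  field_simp
  ring

theorem phi_nonpos {x : ℝ} (hx : 0 < x) : phi x ≤ 0 := by
  have := nonneg_of_le_of_tendsto (f := fun x => -phi x) (fun x hx => ?_)
    (fun x hx => by simpa using (tendsto_phi_add_nat x hx).neg) hx
  · linarith
  · linarith [phi_sub_phi_add_one hx, log_one_add_inv_le hx]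

theorem neg_inv_sq_le_phi {x : ℝ} (hx : 0 < x) : -(1 / (8 * x ^ 2)) ≤ phi x := by
  have := nonneg_of_le_of_tendsto (f := fun x => phi x + 1 / (8 * x ^ 2)) (fun x hx => ?_)
    (fun x hx => ?_) hx
  · linarith
  · have h := le_log_one_add_of_nonneg (x := 1 / x) (by positivity)
    have key : (1 / x + 1 / (x + 1)) / 2 - 2 * (1 / x) / (1 / x + 2) ≤
        1 / (8 * x ^ 2) - 1 / (8 * (x + 1) ^ 2) := by
      rw [← sub_nonneg]
      have : 1 / (8 * x ^ 2) - 1 / (8 * (x + 1) ^ 2) -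
          ((1 / x + 1 / (x + 1)) / 2 - 2 * (1 / x) / (1 / x + 2)) =
          1 / (8 * x ^ 2 * (x + 1) ^ 2 * (2 * x + 1)) := by
        field_simp
        ring
      rw [this]
      positivity
    linarith [phi_sub_phi_add_one hx]
  · have h : Tendsto (fun n : ℕ => 1 / (8 * (x + n) ^ 2)) atTop (𝓝 0) := by
      simp_rw [one_div]
      refine Tendsto.inv_tendsto_atTop (Tendsto.const_mul_atTop (by norm_num) ?_)
      exact (tendsto_pow_atTop two_ne_zero).comp
        (tendsto_atTop_add_const_left _ x tendsto_natCast_atTop_atTop)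
    simpa using (tendsto_phi_add_nat x hx).add h

theorem abs_phi_le {x : ℝ} (hx : 0 < x) : |phi x| ≤ 1 / (8 * x ^ 2) :=
  abs_le.2 ⟨neg_inv_sq_le_phi hx, (phi_nonpos hx).trans (by positivity)⟩

theorem summable_phi {α : ℝ} (hα : 0 < α) : Summable fun n : ℕ => phi ((n + 1) * α) := by
  have h : Summable fun n : ℕ => 1 / (8 * α ^ 2) * (1 / ((n + 1 : ℕ) : ℝ) ^ 2) :=
    ((summable_nat_add_iff 1).2 (Real.summable_one_div_nat_pow.2 one_lt_two)).mul_left _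
  refine h.of_norm_bounded fun n => (abs_phi_le (by positivity)).trans_eq ?_
  push_cast
  field_simp

theorem sum_inv_add_eq_digamma {x : ℝ} (hx : 0 < x) (N : ℕ) :
    ∑ m ∈ Finset.range N, 1 / (x + (m + 1)) = digamma (x + N + 1) - digamma (x + 1) := by
  induction N with
  | zero => simp
  | succ N ih =>
    rw [Finset.sum_range_succ, ih]
    push_cast
    rw [← add_assoc x N 1, digamma_add_one (x := x + N + 1) (by positivity)]
    ring

/-- A discrete antiderivative, with step `α`, of `log y + 1 / (2 * y)` up to `O(1 / y ^ 2)`. -/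
noncomputable def digammaPrimitive (α y : ℝ) : ℝ :=
  (y * log y - y) / α + (1 + α) / (2 * α) * log y

theorem abs_digammaPrimitive_sub_le {α y : ℝ} (hα : 0 < α) (hy : 2 * α ≤ y) :
    |digammaPrimitive α y - digammaPrimitive α (y - α) - (log y + 1 / (2 * y))| ≤
      3 * (1 + α) * α / y ^ 2 := by
  have hy0 : 0 < y := by linarith
  set t := α / y with ht
  have ht0 : 0 < t := by positivity
  have ht1 : t ≤ 1 / 2 := by rw [ht, div_le_div_iff₀ hy0 two_pos]; linarith
  obtain ⟨r, hr⟩ : ∃ r, r = t + t ^ 2 / 2 + log (1 - t) := ⟨_, rfl⟩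
  have hrb : |r| ≤ 2 * t ^ 3 := by
    have h := abs_log_sub_add_sum_range_le (x := t) (by rw [abs_of_pos ht0]; linarith) 2
    norm_num [Finset.sum_range_succ, abs_of_pos ht0] at h
    rw [hr]
    refine h.trans ?_
    rw [div_le_iff₀ (by linarith)]
    nlinarith [pow_pos ht0 3]
  have hlog : log (y - α) = log y + (r - t - t ^ 2 / 2) := by
    have : y - α = y * (1 - t) := by rw [ht]; field_simp
    rw [this, log_mul hy0.ne' (by linarith), hr]
    ring
  have hyt : y = α / t := by rw [ht]; field_simp
  have key : digammaPrimitive α y - digammaPrimitive α (y - α) - (log y + 1 / (2 * y)) =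
      -(1 / t - 1 + (1 + α) / (2 * α)) * r + t ^ 2 * ((1 + α) / (4 * α) - 1 / 2) := by
    rw [digammaPrimitive, digammaPrimitive, hlog, hyt]
    field_simp
    ring
  have hc : |1 / t - 1 + (1 + α) / (2 * α)| ≤ (1 + 1 / (4 * α)) / t := by
    have e : 1 / t - 1 + (1 + α) / (2 * α) = 1 / t - 1 / 2 + 1 / (2 * α) := by
      field_simp
      ring
    have h1 : 2 ≤ 1 / t := by rw [le_div_iff₀ ht0]; linarith
    have h2 : 1 / (2 * α) = 2 * (1 / (4 * α)) := by field_simp; norm_num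
    have h3 : 0 < 1 / (4 * α) := by positivity
    rw [e, abs_of_nonneg (by rw [h2]; linarith), h2, div_eq_mul_one_div (1 + 1 / (4 * α)) t]
    nlinarith
  have hd : |(1 + α) / (4 * α) - 1 / 2| ≤ 1 / 4 + 1 / (4 * α) := by
    have e : (1 + α) / (4 * α) - 1 / 2 = 1 / (4 * α) - 1 / 4 := by field_simp; ring
    have h3 : 0 < 1 / (4 * α) := by positivity
    rw [e, abs_le]
    constructor <;> linarith
  rw [key]
  calc _ ≤ |1 / t - 1 + (1 + α) / (2 * α)| * |r| + t ^ 2 * |(1 + α) / (4 * α) - 1 / 2| := by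
        refine (abs_add_le _ _).trans_eq ?_
        rw [abs_mul, abs_neg, abs_mul, abs_of_pos (pow_pos ht0 2)]
    _ ≤ (1 + 1 / (4 * α)) / t * (2 * t ^ 3) + t ^ 2 * (1 / 4 + 1 / (4 * α)) := by gcongr
    _ = (9 / 4 + 3 / (4 * α)) * t ^ 2 := by field_simp; ring
    _ = (9 / 4 * α + 3 / 4) * α / y ^ 2 := by rw [ht]; field_simp
    _ ≤ 3 * (1 + α) * α / y ^ 2 := by gcongr; linarith

theorem abs_digamma_add_one_sub_le {α y : ℝ} (hα : 0 < α) (hy : 2 * α ≤ y) :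
    |digamma (y + 1) - (digammaPrimitive α y - digammaPrimitive α (y - α))| ≤
      (1 + 3 * (1 + α) * α) / y ^ 2 := by
  have hy0 : 0 < y := by linarith
  have h1 := abs_le.1 (abs_digammaPrimitive_sub_le hα hy)
  have h2 := abs_le.1 (abs_phi_le hy0)
  have h3 : 1 / (8 * y ^ 2) ≤ 1 / y ^ 2 := by
    gcongr
    nlinarith [sq_nonneg y]
  have h4 : digamma (y + 1) = phi y + (log y + 1 / (2 * y)) := by
    rw [digamma_add_one hy0, phi]
    field_simp
    ring
  rw [h4, abs_le, add_div]
  constructor <;> linarith [h1.1, h1.2, h2.1, h2.2]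

theorem tendsto_sum_digamma_sub {α : ℝ} (hα : 0 < α) :
    Tendsto (fun N : ℕ => ∑ n ∈ Finset.range N, digamma ((n + 1) * α + N + 1) -
      (N * log N - N + (1 + α) / α * (N + 1 / 2) * log (1 + α))) atTop (𝓝 0) := by
  have hlim : Tendsto (fun N : ℕ => (1 + 3 * (1 + α) * α) / (N : ℝ)) atTop (𝓝 0) :=
    tendsto_const_nhds.div_atTop tendsto_natCast_atTop_atTop
  refine squeeze_zero_norm' ?_ hlim
  filter_upwards [eventually_gt_atTop 0, tendsto_natCast_atTop_atTop.eventually_ge_atTop α]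
    with N hN hNα
  have hN0 : (0 : ℝ) < N := by exact_mod_cast hN
  have htel : ∑ n ∈ Finset.range N, (digammaPrimitive α ((n + 1) * α + N) -
      digammaPrimitive α ((n + 1) * α + N - α)) =
      N * log N - N + (1 + α) / α * (N + 1 / 2) * log (1 + α) := by
    have h := Finset.sum_range_sub (fun n : ℕ => digammaPrimitive α (n * α + N)) N
    have e : ∀ n : ℕ, (n + 1) * α + N - α = n * α + N := fun n => by ring
    push_cast at h
    simp_rw [e, h]
    have e' : N * α + N = N * (1 + α) := by ring
    rw [digammaPrimitive, digammaPrimitive, e', log_mul hN0.ne' (by positivity), zero_mul,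
      zero_add]
    field_simp
    ring
  rw [← htel, ← Finset.sum_sub_distrib]
  calc _ ≤ ∑ n ∈ Finset.range N, (1 + 3 * (1 + α) * α) / (N : ℝ) ^ 2 := by
        refine norm_sum_le_of_le _ fun n _ => ?_
        have hnα : 0 ≤ n * α := by positivity
        refine (abs_digamma_add_one_sub_le hα (by linarith)).trans ?_
        gcongr
        linarith
    _ = (1 + 3 * (1 + α) * α) / (N : ℝ) := by
        rw [Finset.sum_const, Finset.card_range, nsmul_eq_mul]
        field_simp

theorem tendsto_log_factorial_sub :
    Tendsto (fun N : ℕ => log N.factorial - (N * log N - N + log (2 * π * N) / 2))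
      atTop (𝓝 0) := by
  have h := (Stirling.tendsto_stirlingSeq_sqrt_pi.log (by positivity)).sub_const (log √π)
  rw [sub_self] at h
  refine h.congr' ?_
  filter_upwards [eventually_gt_atTop 0] with N hN
  have hN0 : (0 : ℝ) < N := by exact_mod_cast hN
  rw [Stirling.log_stirlingSeq_formula, log_sqrt pi_pos.le, log_div hN0.ne' (exp_pos 1).ne',
    log_exp, log_mul two_ne_zero hN0.ne', log_mul two_pi_pos.ne' hN0.ne',
    log_mul two_ne_zero pi_pos.ne']
  ring

theorem sum_phi_eq {α : ℝ} (hα : 0 < α) (N : ℕ) :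
    ∑ n ∈ Finset.range N, phi ((n + 1) * α) =
      ∑ n ∈ Finset.range N, digamma ((n + 1) * α + N + 1) -
      ∑ n ∈ Finset.range N, ∑ m ∈ Finset.range N, 1 / ((n + 1) * α + (m + 1)) -
      harmonic N / (2 * α) - log N.factorial - N * log α := by
  have hH : (harmonic N : ℝ) / (2 * α) = ∑ n ∈ Finset.range N, 1 / (2 * ((n + 1) * α)) := by
    rw [harmonic]
    push_cast
    rw [Finset.sum_div]
    refine Finset.sum_congr rfl fun n _ => ?_
    field_simp
  have hF : log N.factorial = ∑ n ∈ Finset.range N, log (n + 1) := by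
    rw [← Finset.prod_range_add_one_eq_factorial]
    push_cast
    exact log_prod fun n _ => by positivity
  have hL : N * log α = ∑ _n ∈ Finset.range N, log α := by simp
  rw [hH, hF, hL, ← Finset.sum_sub_distrib, ← Finset.sum_sub_distrib, ← Finset.sum_sub_distrib,
    ← Finset.sum_sub_distrib]
  refine Finset.sum_congr rfl fun n _ => ?_
  have hx : 0 < (n + 1) * α := by positivity
  rw [sum_inv_add_eq_digamma hx, digamma_add_one hx, phi, log_mul (by positivity) hα.ne']
  field_simp
  ring

/-- The main part of the partial sums of `Σ φ(n α)`; multiplied by `√α` and stripped of its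
constant term it is invariant under `α ↦ α⁻¹`. -/
noncomputable def partialSumMain (α : ℝ) (N : ℕ) : ℝ :=
  (1 + α) / α * (N + 1 / 2) * log (1 + α) - N * log α - log (2 * π * N) / 2 -
    (log N + eulerMascheroniConstant) / (2 * α) -
    ∑ n ∈ Finset.range N, ∑ m ∈ Finset.range N, 1 / ((n + 1) * α + (m + 1))

theorem tendsto_sum_phi_sub_main {α : ℝ} (hα : 0 < α) :
    Tendsto (fun N : ℕ => ∑ n ∈ Finset.range N, phi ((n + 1) * α) - partialSumMain α N)
      atTop (𝓝 0) := by
  have hH := (tendsto_harmonic_sub_log.sub_const eulerMascheroniConstant).div_const (2 * α)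
  have h := ((tendsto_sum_digamma_sub hα).sub tendsto_log_factorial_sub).sub hH
  simp only [sub_self, zero_div] at h
  refine h.congr fun N => ?_
  rw [sum_phi_eq hα, partialSumMain]
  ring

theorem sqrt_mul_partialSumMain_eq {α β : ℝ} (hα : 0 < α) (hβ : 0 < β) (hαβ : α * β = 1)
    {N : ℕ} (hN : 0 < N) :
    √α * ((eulerMascheroniConstant - log (2 * π * α)) / (2 * α) + partialSumMain α N) =
      √β * ((eulerMascheroniConstant - log (2 * π * β)) / (2 * β) + partialSumMain β N) := by
  have hN0 : (0 : ℝ) < N := by exact_mod_cast hN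
  obtain ⟨a, ha, rfl⟩ : ∃ a : ℝ, 0 < a ∧ α = a ^ 2 := ⟨√α, sqrt_pos.2 hα, (sq_sqrt hα.le).symm⟩
  obtain rfl : β = a⁻¹ ^ 2 := by
    field_simp
    linarith
  have hD : a * ∑ n ∈ Finset.range N, ∑ m ∈ Finset.range N, 1 / (((n : ℝ) + 1) * a ^ 2 + (m + 1))
      = a⁻¹ * ∑ n ∈ Finset.range N, ∑ m ∈ Finset.range N,
        1 / (((n : ℝ) + 1) * a⁻¹ ^ 2 + (m + 1)) := by
    rw [Finset.sum_comm]
    simp_rw [Finset.mul_sum]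
    refine Finset.sum_congr rfl fun n _ => Finset.sum_congr rfl fun m _ => ?_
    field_simp
    ring
  have hlog : log (1 + a⁻¹ ^ 2) = log (1 + a ^ 2) - 2 * log a := by
    have : 1 + a⁻¹ ^ 2 = (1 + a ^ 2) / a ^ 2 := by field_simp; ring
    rw [this, log_div (by positivity) (by positivity), log_pow]
    norm_num
  rw [sqrt_sq ha.le, sqrt_sq (by positivity), partialSumMain, partialSumMain, hlog]
  simp only [mul_add a, mul_add a⁻¹, mul_sub a, mul_sub a⁻¹, hD]
  rw [log_mul two_pi_pos.ne' hα.ne', log_mul two_pi_pos.ne' hβ.ne',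
    log_mul two_pi_pos.ne' hN0.ne', log_pow, log_pow, log_inv]
  push_cast
  field_simp
  ring

theorem ramanujan_transformation_symmetry (α β : ℝ) (hα : 0 < α) (hβ : 0 < β)
    (hαβ : α * β = 1) :
    Summable (fun n : ℕ => phi ((n + 1) * α)) ∧
    Summable (fun n : ℕ => phi ((n + 1) * β)) ∧
    Real.sqrt α * ((Real.eulerMascheroniConstant - Real.log (2 * π * α)) / (2 * α)
        + ∑' n : ℕ, phi ((n + 1) * α))
      = Real.sqrt β * ((Real.eulerMascheroniConstant - Real.log (2 * π * β)) / (2 * β)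
        + ∑' n : ℕ, phi ((n + 1) * β)) := by
  refine ⟨summable_phi hα, summable_phi hβ, ?_⟩
  have key : ∀ x : ℝ, 0 < x → Tendsto (fun N : ℕ =>
      √x * ((eulerMascheroniConstant - log (2 * π * x)) / (2 * x) + partialSumMain x N)) atTop
      (𝓝 (√x * ((eulerMascheroniConstant - log (2 * π * x)) / (2 * x) +
        ∑' n : ℕ, phi ((n + 1) * x)))) := fun x hx => by
    have h := (summable_phi hx).hasSum.tendsto_sum_nat.sub (tendsto_sum_phi_sub_main hx)
    simp only [sub_sub_cancel, sub_zero] at h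
    exact (h.const_add _).const_mul _
  refine tendsto_nhds_unique (key α hα) ((key β hβ).congr' ?_)
  filter_upwards [eventually_gt_atTop 0] with N hN
  exact (sqrt_mul_partialSumMain_eq hα hβ hαβ hN).symm
end

section
/- For every complex z with |arg z| < π, Σ_{n=1}^∞ ( (Γ'/Γ)(nz) - log(nz) + 1/(2nz) ) + (1/(2z))(γ - log(2πz)) = (1/z) Σ_{n=1}^∞ ( (Γ'/Γ)(n/z) - log(n/z) + z/(2n) ) + (1/2)(γ - log(2π/z)), where Γ is the complex Gamma function, log denotes the principal branch of the logarithm, and both series converge. -/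
open Real MeasureTheory Filter

/-- The logarithmic derivative `Γ'/Γ` of the complex Gamma function. -/
noncomputable def cdigamma (w : ℂ) : ℂ := deriv Complex.Gamma w / Complex.Gamma w
open Topology

theorem Complex.ofReal_mul_add_ofReal_mem_slitPlane {z : ℂ} (hz : z ∈ Complex.slitPlane)
    {x y : ℝ} (hx : 0 ≤ x) (hy : 0 ≤ y) (hxy : 0 < x + y) :
    (x : ℂ) * z + y ∈ Complex.slitPlane := by
  rw [Complex.mem_slitPlane_iff] at hz ⊢
  rcases hx.eq_or_lt with rfl | hx
  · left; simpa using hxy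
  · rcases hz with h | h
    · left; simp; positivity
    · right; simp [hx.ne', h]

theorem inv_mem_slitPlane {z : ℂ} (hz : z ∈ Complex.slitPlane) : z⁻¹ ∈ Complex.slitPlane := by
  rw [Complex.mem_slitPlane_iff_arg] at hz ⊢
  refine ⟨?_, inv_ne_zero hz.2⟩
  rw [Complex.arg_inv, if_neg hz.1]
  intro h
  linarith [Complex.neg_pi_lt_arg z]

theorem exists_forall_mul_add_le_norm {z : ℂ} (hz : z ∈ Complex.slitPlane) :
    ∃ c : ℝ, 0 < c ∧ ∀ x y : ℝ, 0 ≤ x → 0 ≤ y → c * (x + y) ≤ ‖(x : ℂ) * z + y‖ := by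
  obtain ⟨t, ht, hmin⟩ := isCompact_Icc.exists_isMinOn (Set.nonempty_Icc.2 zero_le_one)
    (f := fun t : ℝ => ‖(t : ℂ) * z + (1 - t : ℝ)‖) (by fun_prop)
  refine ⟨_, norm_pos_iff.2 (Complex.slitPlane_ne_zero
    (Complex.ofReal_mul_add_ofReal_mem_slitPlane hz ht.1 (sub_nonneg.2 ht.2) (by simp))),
    fun x y hx hy => ?_⟩
  rcases (add_nonneg hx hy).eq_or_lt with h | h
  · rw [← h]; simp
  · have key := isMinOn_iff.1 hmin (x / (x + y))
      ⟨by positivity, (div_le_one h).2 (by linarith)⟩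
    have hne : (x : ℂ) + y ≠ 0 := by exact_mod_cast h.ne'
    have : (x : ℂ) * z + y
        = ((x + y : ℝ) : ℂ) * (((x / (x + y) : ℝ) : ℂ) * z + (1 - x / (x + y) : ℝ)) := by
      push_cast; field_simp; ring
    rw [this, norm_mul, Complex.norm_real, Real.norm_of_nonneg h.le, mul_comm]
    gcongr

/-- The error of the trapezoidal rule for `∫ dt / t` over `[w, w + 1]`. -/
noncomputable def trapezoidErrorInv (w : ℂ) : ℂ :=
  Complex.log (w + 1) - Complex.log w - 1 / 2 * (1 / w + 1 / (w + 1))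

/-- An antiderivative of the logarithm. -/
noncomputable def logPrimitive (w : ℂ) : ℂ := w * Complex.log w - w

/-- The error of the trapezoidal rule for `∫ log t dt` over `[w, w + 1]`. -/
noncomputable def trapezoidErrorLog (w : ℂ) : ℂ :=
  logPrimitive (w + 1) - logPrimitive w - 1 / 2 * (Complex.log w + Complex.log (w + 1))

theorem hasDerivAt_log_add_ofReal {w : ℂ} {t : ℝ} (h : w + t ∈ Complex.slitPlane) :
    HasDerivAt (fun s : ℝ => Complex.log (w + s)) (1 / (w + t)) t :=
  ((Complex.ofRealCLM.hasDerivAt (x := t)).const_add w).clog_real h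

theorem norm_trapezoidErrorInv_le {w : ℂ} {m : ℝ} (hm : 0 < m)
    (hs : ∀ t ∈ Set.Icc (0 : ℝ) 1, w + t ∈ Complex.slitPlane)
    (hb : ∀ t ∈ Set.Icc (0 : ℝ) 1, m ≤ ‖w + t‖) :
    ‖trapezoidErrorInv w‖ ≤ 1 / (2 * m ^ 3) := by
  have hw0 : w ≠ 0 := by simpa using Complex.slitPlane_ne_zero (hs 0 (by simp))
  have hw : m ≤ ‖w‖ := by simpa using hb 0 (by simp)
  have key := norm_image_sub_le_of_norm_deriv_le_segment_01'
    (f := fun t : ℝ => Complex.log (w + t) - Complex.log w - t / 2 * (1 / w + 1 / (w + t)))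
    (f' := fun t : ℝ => -(t : ℂ) ^ 2 / (2 * w * (w + t) ^ 2)) (C := 1 / (2 * m ^ 3)) ?_ ?_
  · simpa [trapezoidErrorInv] using key
  · intro t ht
    have h0 := Complex.slitPlane_ne_zero (hs t ht)
    have hid : HasDerivAt (fun s : ℝ => (s : ℂ)) 1 t := Complex.ofRealCLM.hasDerivAt (x := t)
    have := (((hasDerivAt_log_add_ofReal (hs t ht)).sub_const (Complex.log w)).sub
      ((hid.div_const 2).mul (((hid.const_add w).inv h0).const_add (1 / w))))
    refine (this.congr_deriv ?_).hasDerivWithinAt.congr_of_eventuallyEq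
      (Filter.Eventually.of_forall fun s => ?_) ?_
    · simp only [Pi.inv_apply]
      field_simp
      ring
    · simp
    · simp
  · intro t ht
    have ht' := Set.Ico_subset_Icc_self ht
    rw [norm_div, norm_neg, norm_pow, norm_mul, norm_mul, norm_pow, Complex.norm_real,
      Complex.norm_two, Real.norm_of_nonneg ht.1]
    have := hb t ht'
    have h1 : t ^ 2 ≤ 1 := pow_le_one₀ ht.1 ht.2.le
    calc t ^ 2 / (2 * ‖w‖ * ‖w + t‖ ^ 2) ≤ 1 / (2 * m * m ^ 2) := by gcongr
      _ = _ := by ring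

theorem norm_trapezoidErrorLog_le {w : ℂ} {m : ℝ} (hm : 0 < m)
    (hs : ∀ t ∈ Set.Icc (0 : ℝ) 1, w + t ∈ Complex.slitPlane)
    (hb : ∀ t ∈ Set.Icc (0 : ℝ) 1, m ≤ ‖w + t‖) :
    ‖trapezoidErrorLog w‖ ≤ 1 / m ^ 2 := by
  have hid (t : ℝ) : HasDerivAt (fun s : ℝ => (s : ℂ)) 1 t := Complex.ofRealCLM.hasDerivAt (x := t)
  have hbound (t : ℝ) (ht : t ∈ Set.Icc (0 : ℝ) 1) :
      ‖Complex.log (w + t) - Complex.log w - t / (w + t)‖ ≤ 1 / m ^ 2 := by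
    have key := norm_image_sub_le_of_norm_deriv_le_segment'
      (f := fun t : ℝ => Complex.log (w + t) - Complex.log w - t / (w + t))
      (f' := fun t : ℝ => (t : ℂ) / (w + t) ^ 2) (C := 1 / m ^ 2) (a := 0) (b := 1) ?_ ?_ t ht
    · refine (le_of_eq ?_).trans (key.trans ?_)
      · simp
      · exact mul_le_of_le_one_right (by positivity) (by simpa using ht.2)
    · intro t ht
      have h0 := Complex.slitPlane_ne_zero (hs t ht)
      have := ((hasDerivAt_log_add_ofReal (hs t ht)).sub_const (Complex.log w)).sub
        ((hid t).div ((hid t).const_add w) h0)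
      refine (this.congr_deriv ?_).hasDerivWithinAt
      field_simp; ring
    · intro t ht
      rw [norm_div, norm_pow, Complex.norm_real, Real.norm_of_nonneg ht.1]
      have := hb t (Set.Ico_subset_Icc_self ht)
      have := ht.2.le
      gcongr
  have key := norm_image_sub_le_of_norm_deriv_le_segment_01'
    (f := fun t : ℝ => logPrimitive (w + t) - logPrimitive w
      - t / 2 * (Complex.log w + Complex.log (w + t)))
    (f' := fun t : ℝ => 1 / 2 * (Complex.log (w + t) - Complex.log w - t / (w + t)))
    (C := 1 / m ^ 2) ?_ ?_
  · simpa [trapezoidErrorLog] using key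
  · intro t ht
    have h0 := Complex.slitPlane_ne_zero (hs t ht)
    have hl := hasDerivAt_log_add_ofReal (hs t ht)
    have := ((((((hid t).const_add w).mul hl).sub ((hid t).const_add w))).sub_const
      (logPrimitive w)).sub (((hid t).div_const 2).mul (hl.const_add (Complex.log w)))
    refine (this.congr_deriv ?_).hasDerivWithinAt
    field_simp; ring
  · intro t ht
    rw [norm_mul]
    have := hbound t (Set.Ico_subset_Icc_self ht)
    have h2 : ‖(1 / 2 : ℂ)‖ = 1 / 2 := by simp
    rw [h2]
    linarith [norm_nonneg (Complex.log (w + t) - Complex.log w - t / (w + t))]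

theorem log_ofReal_div_add_ofReal {z : ℂ} (hz : z ∈ Complex.slitPlane) {x y : ℝ} (hx : 0 < x)
    (hy : 0 ≤ y) :
    Complex.log (x / z + y) = Complex.log (x + y * z) - Complex.log z := by
  have hz0 := Complex.slitPlane_ne_zero hz
  have hzi : z⁻¹ ∈ Complex.slitPlane := inv_mem_slitPlane hz
  have h1 (t : ℝ) (ht : 0 ≤ t) : (x : ℂ) / z + t ∈ Complex.slitPlane := by
    rw [div_eq_mul_inv]
    exact Complex.ofReal_mul_add_ofReal_mem_slitPlane hzi hx.le ht (by linarith)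
  have h2 (t : ℝ) (ht : 0 ≤ t) : (x : ℂ) + t * z ∈ Complex.slitPlane := by
    rw [add_comm]
    exact Complex.ofReal_mul_add_ofReal_mem_slitPlane hz ht hx.le (by linarith)
  have hd (t : ℝ) (ht : 0 ≤ t) : HasDerivAt
      (fun s : ℝ => Complex.log (x / z + s) - Complex.log (x + s * z)) 0 t := by
    have hid : HasDerivAt (fun s : ℝ => (s : ℂ)) 1 t := Complex.ofRealCLM.hasDerivAt (x := t)
    refine ((hasDerivAt_log_add_ofReal (h1 t ht)).sub
      (((hid.mul_const z).const_add (x : ℂ)).clog_real (h2 t ht))).congr_deriv ?_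
    have := Complex.slitPlane_ne_zero (h1 t ht)
    have h3 := Complex.slitPlane_ne_zero (h2 t ht)
    have : (x : ℂ) / z + t = (x + t * z) / z := by field_simp
    rw [this]
    field_simp
    ring
  have := constant_of_has_deriv_right_zero (a := 0) (b := y)
    (fun t ht => (hd t ht.1).continuousAt.continuousWithinAt)
    (fun t ht => (hd t ht.1).hasDerivWithinAt) y ⟨hy, le_rfl⟩
  have h0 : Complex.log ((x : ℂ) / z) = Complex.log x - Complex.log z := by
    rw [div_eq_mul_inv, Complex.log_ofReal_mul hx (inv_ne_zero hz0),
      Complex.log_inv _ (Complex.slitPlane_arg_ne_pi hz), Complex.ofReal_log hx.le]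
    ring
  simp only [Complex.ofReal_zero, add_zero, zero_mul, h0] at this
  linear_combination this

theorem ne_neg_natCast_of_mem_slitPlane {w : ℂ} (hw : w ∈ Complex.slitPlane) (m : ℕ) :
    w ≠ -m := by
  rintro rfl
  rw [Complex.mem_slitPlane_iff] at hw
  rcases hw with h | h
  · simp only [Complex.neg_re, Complex.natCast_re] at h
    linarith [(Nat.cast_nonneg m : (0 : ℝ) ≤ m)]
  · simp at h

/-- The remainder of the digamma function after its first two asymptotic terms. -/
noncomputable def digammaRemainder (w : ℂ) : ℂ := cdigamma w - Complex.log w + 1 / (2 * w)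

theorem digammaRemainder_sub_add_one {w : ℂ} (hw : w ∈ Complex.slitPlane) :
    digammaRemainder w - digammaRemainder (w + 1) = trapezoidErrorInv w := by
  have h0 := Complex.slitPlane_ne_zero hw
  have h1 : w + 1 ≠ 0 := fun h => ne_neg_natCast_of_mem_slitPlane hw 1 (by
    linear_combination h + (Nat.cast_one (R := ℂ)))
  have h : cdigamma (w + 1) = cdigamma w + w⁻¹ :=
    Complex.digamma_apply_add_one w (ne_neg_natCast_of_mem_slitPlane hw)
  rw [digammaRemainder, digammaRemainder, trapezoidErrorInv, h]
  field_simp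
  ring

theorem differentiableOn_digammaRemainder :
    DifferentiableOn ℂ digammaRemainder Complex.slitPlane := by
  have hG : DifferentiableOn ℂ Complex.Gamma Complex.slitPlane := fun w hw =>
    (Complex.differentiableAt_Gamma w
      (ne_neg_natCast_of_mem_slitPlane hw)).differentiableWithinAt
  refine (((hG.deriv Complex.isOpen_slitPlane).div hG fun w hw =>
    Complex.Gamma_ne_zero (ne_neg_natCast_of_mem_slitPlane hw)).sub
    (differentiableOn_id.clog fun w hw => hw)).add
    ((differentiableOn_const 1).div (differentiableOn_id.const_mul 2) fun w hw => ?_)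
  simpa using Complex.slitPlane_ne_zero hw

theorem norm_cdigamma_sub_log_le {x : ℝ} (hx : 1 < x) :
    ‖cdigamma x - Complex.log x‖ ≤ 1 / (x - 1) := by
  have hx0 : 0 < x := by linarith
  have hne (m : ℕ) : x ≠ -m := by
    have : (0 : ℝ) ≤ m := Nat.cast_nonneg m
    linarith
  have hR := (Real.differentiableAt_Gamma hne).hasDerivAt
  have hC := (Complex.differentiableAt_Gamma x (fun m h => hne m (by exact_mod_cast h))).hasDerivAt
  have hderiv : deriv Complex.Gamma x = (deriv Real.Gamma x : ℝ) := by
    refine hC.comp_ofReal.unique ?_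
    simpa only [Complex.Gamma_ofReal] using hR.ofReal_comp
  have hpos := Real.Gamma_pos_of_pos hx0
  have hL := hR.log hpos.ne'
  have hdig : cdigamma x = (deriv Real.Gamma x / Real.Gamma x : ℝ) := by
    rw [cdigamma, hderiv, Complex.Gamma_ofReal]
    push_cast
    rfl
  have hstep (y : ℝ) (hy : 0 < y) : slope (Real.log ∘ Real.Gamma) y (y + 1) = Real.log y := by
    rw [slope_def_field]
    simp only [Function.comp_apply]
    rw [Real.Gamma_add_one hy.ne', Real.log_mul hy.ne' (Real.Gamma_pos_of_pos hy).ne']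
    ring
  have hup := Real.convexOn_log_Gamma.le_slope_of_hasDerivAt (Set.mem_Ioi.2 hx0)
    (Set.mem_Ioi.2 (by linarith : 0 < x + 1)) (by linarith) hL
  have hlow := Real.convexOn_log_Gamma.slope_le_of_hasDerivAt
    (Set.mem_Ioi.2 (by linarith : 0 < x - 1)) (Set.mem_Ioi.2 hx0) (by linarith) hL
  rw [hstep x hx0] at hup
  have hs := hstep (x - 1) (by linarith)
  rw [sub_add_cancel] at hs
  rw [hs] at hlow
  have hlog : Real.log x - Real.log (x - 1) ≤ 1 / (x - 1) := by
    have hx1 : 0 < x - 1 := by linarith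
    rw [← Real.log_div hx0.ne' hx1.ne']
    refine (Real.log_le_sub_one_of_pos (by positivity)).trans (le_of_eq ?_)
    field_simp
    ring
  rw [hdig, ← Complex.ofReal_log hx0.le, ← Complex.ofReal_sub, Complex.norm_real, Real.norm_eq_abs,
    abs_le]
  constructor <;> linarith

theorem tendsto_digammaRemainder_add_natCast {x : ℝ} (hx : 0 < x) :
    Tendsto (fun n : ℕ => digammaRemainder (x + n)) atTop (𝓝 0) := by
  have hlim : Tendsto (fun n : ℕ => 1 / ((n : ℝ) + (x - 1)) + 1 / ((n : ℝ) + x)) atTop (𝓝 0) := by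
    have h (a : ℝ) : Tendsto (fun n : ℕ => 1 / ((n : ℝ) + a)) atTop (𝓝 0) := by
      simp only [one_div]
      exact (tendsto_atTop_add_const_right _ a tendsto_natCast_atTop_atTop).inv_tendsto_atTop
    simpa using (h (x - 1)).add (h x)
  refine squeeze_zero_norm' ?_ hlim
  filter_upwards [eventually_ge_atTop 1] with n hn
  have hn' : (1 : ℝ) ≤ n := by exact_mod_cast hn
  have h := norm_cdigamma_sub_log_le (x := n + x) (by linarith)
  have hcast : (x : ℂ) + n = ((n + x : ℝ) : ℂ) := by push_cast; ring
  rw [digammaRemainder, hcast]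
  refine (norm_add_le _ _).trans (add_le_add ?_ ?_)
  · rwa [add_sub_assoc] at h
  · rw [norm_div, norm_mul, Complex.norm_real, norm_one, Complex.norm_two,
      Real.norm_of_nonneg (by linarith)]
    have : 0 < n + x := by linarith
    gcongr
    linarith

theorem sum_trapezoidErrorInv_eq {w : ℂ} (hw : w ∈ Complex.slitPlane) (n : ℕ) :
    ∑ k ∈ Finset.range n, trapezoidErrorInv (w + k)
      = digammaRemainder w - digammaRemainder (w + n) := by
  induction n with
  | zero => simp
  | succ n ih =>
    have hn : w + n ∈ Complex.slitPlane := by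
      simpa using Complex.ofReal_mul_add_ofReal_mem_slitPlane hw zero_le_one
        (Nat.cast_nonneg n) (by positivity)
    rw [Finset.sum_range_succ, ih, ← digammaRemainder_sub_add_one hn]
    push_cast
    ring_nf

theorem norm_trapezoidErrorInv_le_of_lower_bound {z : ℂ} (hz : z ∈ Complex.slitPlane) {c : ℝ}
    (hc : 0 < c) {x : ℝ} (hx : 0 < x)
    (h : ∀ y : ℝ, 0 ≤ y → c * (x + y) ≤ ‖(x : ℂ) * z + y‖) (k : ℕ) :
    ‖trapezoidErrorInv (x * z + k)‖ ≤ 1 / (2 * (c * (x + k)) ^ 3) := by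
  refine norm_trapezoidErrorInv_le (by positivity) (fun t ht => ?_) (fun t ht => ?_)
  · have := Complex.ofReal_mul_add_ofReal_mem_slitPlane hz hx.le
      (add_nonneg (Nat.cast_nonneg k) ht.1) (add_pos_of_pos_of_nonneg hx
      (add_nonneg (Nat.cast_nonneg k) ht.1))
    push_cast at this
    rwa [add_assoc]
  · have := h (k + t) (add_nonneg (Nat.cast_nonneg k) ht.1)
    push_cast at this
    rw [add_assoc]
    refine le_trans ?_ this
    have := ht.1
    gcongr
    linarith

theorem summable_one_div_natCast_add_one_pow_three (C : ℝ) :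
    Summable fun k : ℕ => 1 / (2 * (C * (1 + (k : ℝ))) ^ 3) := by
  have h := (summable_nat_add_iff 1).2 (Real.summable_one_div_nat_pow.2 (by norm_num : 1 < 3))
  refine (h.mul_left (1 / (2 * C ^ 3))).congr fun k => ?_
  push_cast
  rw [div_mul_div_comm]
  ring_nf

theorem summable_trapezoidErrorInv {w : ℂ} (hw : w ∈ Complex.slitPlane) :
    Summable fun k : ℕ => trapezoidErrorInv (w + k) := by
  obtain ⟨c, hc, h⟩ := exists_forall_mul_add_le_norm hw
  refine Summable.of_norm_bounded (summable_one_div_natCast_add_one_pow_three c) fun k => ?_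
  simpa only [Complex.ofReal_one, one_mul] using
    norm_trapezoidErrorInv_le_of_lower_bound hw hc one_pos (fun y hy => h 1 y zero_le_one hy) k

theorem differentiableOn_tsum_trapezoidErrorInv :
    DifferentiableOn ℂ (fun w => ∑' k : ℕ, trapezoidErrorInv (w + k)) Complex.slitPlane := by
  intro w₀ hw₀
  obtain ⟨c, hc, h⟩ := exists_forall_mul_add_le_norm hw₀
  have hopen : IsOpen (Metric.ball w₀ (c / 2) ∩ Complex.slitPlane) :=
    Metric.isOpen_ball.inter Complex.isOpen_slitPlane
  have hmem (w : ℂ) (hw : w ∈ Complex.slitPlane) (y : ℝ) (hy : 0 ≤ y) :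
      w + y ∈ Complex.slitPlane := by
    simpa using Complex.ofReal_mul_add_ofReal_mem_slitPlane hw zero_le_one hy (by positivity)
  have key : DifferentiableOn ℂ (fun w => ∑' k : ℕ, trapezoidErrorInv (w + k))
      (Metric.ball w₀ (c / 2) ∩ Complex.slitPlane) := by
    refine Complex.differentiableOn_tsum_of_summable_norm
      (summable_one_div_natCast_add_one_pow_three (c / 2)) (fun k w hw => ?_) hopen
      (fun k w hw => ?_)
    · have h1 : w + k ∈ Complex.slitPlane := by simpa using hmem w hw.2 k (Nat.cast_nonneg k)
      have h2 : w + k + 1 ∈ Complex.slitPlane := by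
        simpa using hmem _ h1 1 zero_le_one
      have hid : DifferentiableAt ℂ (fun v : ℂ => v + k) w := by fun_prop
      refine DifferentiableAt.differentiableWithinAt ?_
      unfold trapezoidErrorInv
      refine (((hid.add_const 1).clog h2).sub (hid.clog h1)).sub ((((differentiableAt_const 1).div
        hid ?_).add ((differentiableAt_const 1).div (hid.add_const 1) ?_)).const_mul _)
      exacts [Complex.slitPlane_ne_zero h1, Complex.slitPlane_ne_zero h2]
    · have := norm_trapezoidErrorInv_le_of_lower_bound hw.2 (half_pos hc) one_pos (fun y hy => ?_) k
      · simpa only [Complex.ofReal_one, one_mul] using this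
      · have h1 := h 1 y zero_le_one hy
        have h2 : ‖w₀ - w‖ < c / 2 := by
          simpa [dist_eq_norm, norm_sub_rev] using hw.1
        have h3 := norm_sub_norm_le (w₀ + y) (w₀ - w)
        rw [show w₀ + y - (w₀ - w) = w + y by ring] at h3
        simp only [Complex.ofReal_one, one_mul] at h1 ⊢
        nlinarith
  exact (key.differentiableAt (hopen.mem_nhds
    ⟨Metric.mem_ball_self (half_pos hc), hw₀⟩)).differentiableWithinAt

theorem hasSum_trapezoidErrorInv {w : ℂ} (hw : w ∈ Complex.slitPlane) :
    HasSum (fun k : ℕ => trapezoidErrorInv (w + k)) (digammaRemainder w) := by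
  have hreal (x : ℝ) (hx : 0 < x) :
      digammaRemainder x = ∑' k : ℕ, trapezoidErrorInv (x + k) := by
    have hx' : (x : ℂ) ∈ Complex.slitPlane := Complex.ofReal_mem_slitPlane.2 hx
    refine tendsto_nhds_unique ?_ (summable_trapezoidErrorInv hx').hasSum.tendsto_sum_nat
    simp only [sum_trapezoidErrorInv_eq hx']
    simpa using (tendsto_digammaRemainder_add_natCast hx).const_sub (digammaRemainder x)
  have heq := AnalyticOnNhd.eqOn_of_preconnected_of_frequently_eq (z₀ := 1)
    (differentiableOn_digammaRemainder.analyticOnNhd Complex.isOpen_slitPlane)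
    (differentiableOn_tsum_trapezoidErrorInv.analyticOnNhd Complex.isOpen_slitPlane)
    (Complex.starConvex_one_slitPlane.isPathConnected
      Complex.one_mem_slitPlane).isConnected.isPreconnected Complex.one_mem_slitPlane ?_ hw
  · exact heq ▸ (summable_trapezoidErrorInv hw).hasSum
  · have ht : Tendsto (fun n : ℕ => (((1 : ℝ) + 1 / ((n : ℝ) + 1) : ℝ) : ℂ)) atTop (𝓝[≠] 1) := by
      refine tendsto_nhdsWithin_iff.2 ⟨?_, Filter.Eventually.of_forall fun n => ?_⟩
      · have := (tendsto_one_div_add_atTop_nhds_zero_nat (𝕜 := ℝ)).const_add 1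
        rw [add_zero] at this
        simpa [Function.comp_def] using (Complex.continuous_ofReal.tendsto 1).comp this
      · have : (0 : ℝ) < 1 / ((n : ℝ) + 1) := by positivity
        simp only [Set.mem_compl_iff, Set.mem_singleton_iff]
        intro h
        have h' : (1 : ℝ) + 1 / ((n : ℝ) + 1) = 1 := by exact_mod_cast h
        linarith
    refine ht.frequently (Filter.Frequently.of_forall fun n => ?_)
    exact hreal _ (by positivity)

theorem summable_trapezoidErrorInv_prod {z : ℂ} (hz : z ∈ Complex.slitPlane) :
    Summable fun p : ℕ × ℕ => trapezoidErrorInv ((p.1 + 1) * z + p.2) := by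
  obtain ⟨c, hc, h⟩ := exists_forall_mul_add_le_norm hz
  have hs : Summable fun n : ℕ => 1 / ((n : ℝ) + 1) ^ (3 / 2 : ℝ) := by
    have := (summable_nat_add_iff 1).2
      (Real.summable_one_div_nat_rpow.2 (by norm_num : (1 : ℝ) < 3 / 2))
    simpa using this
  have hp := ((hs.mul_of_nonneg hs (fun n => by positivity) (fun n => by positivity)).mul_left
    (1 / (2 * c ^ 3)))
  refine Summable.of_norm_bounded hp fun p => ?_
  obtain ⟨n, k⟩ := p
  have hb := norm_trapezoidErrorInv_le_of_lower_bound hz hc (x := n + 1) (by positivity)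
    (fun y hy => h _ y (by positivity) hy) k
  push_cast at hb
  refine hb.trans ?_
  have hcube : (((n : ℝ) + 1) * (k + 1)) ^ (3 / 2 : ℝ) ≤ ((n : ℝ) + 1 + k) ^ 3 := by
    calc (((n : ℝ) + 1) * (k + 1)) ^ (3 / 2 : ℝ)
        ≤ (((n : ℝ) + 1 + k) ^ (2 : ℝ)) ^ (3 / 2 : ℝ) := by
          gcongr
          rw [Real.rpow_two]
          have : (0 : ℝ) ≤ n := Nat.cast_nonneg n
          have : (0 : ℝ) ≤ k := Nat.cast_nonneg k
          nlinarith [mul_nonneg ‹(0 : ℝ) ≤ n› ‹(0 : ℝ) ≤ k›]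
      _ = ((n : ℝ) + 1 + k) ^ 3 := by
          rw [← Real.rpow_mul (by positivity), ← Real.rpow_natCast]
          norm_num
  rw [Real.mul_rpow (by positivity) (by positivity)] at hcube
  rw [div_mul_div_comm, div_mul_div_comm, mul_pow, ← mul_assoc, one_mul, one_mul]
  gcongr

theorem hasSum_digammaRemainder {z : ℂ} (hz : z ∈ Complex.slitPlane) :
    HasSum (fun n : ℕ => digammaRemainder ((n + 1) * z))
      (∑' p : ℕ × ℕ, trapezoidErrorInv ((p.1 + 1) * z + p.2)) := by
  have hmem (n : ℕ) : ((n : ℂ) + 1) * z ∈ Complex.slitPlane := by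
    have := Complex.ofReal_mul_add_ofReal_mem_slitPlane hz (x := n + 1) (y := 0)
      (by positivity) le_rfl (by positivity)
    push_cast at this
    rwa [add_zero] at this
  have hrow (n : ℕ) : HasSum (fun k : ℕ => trapezoidErrorInv ((n + 1) * z + k))
      (digammaRemainder ((n + 1) * z)) := hasSum_trapezoidErrorInv (hmem n)
  have hs := (summable_trapezoidErrorInv_prod hz).hasSum
  refine HasSum.prod_fiberwise hs ?_
  intro n
  exact hrow n

theorem tendsto_sum_sum_trapezoidErrorInv {z : ℂ} (hz : z ∈ Complex.slitPlane) :
    Tendsto (fun N : ℕ => ∑ n ∈ Finset.range N, ∑ k ∈ Finset.range N,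
      trapezoidErrorInv ((n + 1) * z + k)) atTop
      (𝓝 (∑' n : ℕ, digammaRemainder ((n + 1) * z))) := by
  rw [(hasSum_digammaRemainder hz).tsum_eq]
  have hpair : Tendsto (fun N : ℕ => (Finset.range N, Finset.range N)) atTop atTop := by
    rw [← Filter.prod_atTop_atTop_eq]
    exact tendsto_finset_range.prodMk tendsto_finset_range
  have ht := Filter.tendsto_finsetProd_atTop.comp hpair
  have hs := (summable_trapezoidErrorInv_prod hz).hasSum
  rw [HasSum, SummationFilter.unconditional_filter] at hs
  refine (hs.comp ht).congr fun N => ?_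
  simp only [Function.comp_apply, Finset.sum_product]

theorem sum_range_trapezoidErrorInv (v : ℂ) (N : ℕ) :
    ∑ k ∈ Finset.range N, trapezoidErrorInv (v + k)
      = Complex.log (v + N) - Complex.log v - ∑ k ∈ Finset.range N, 1 / (v + (k + 1))
        - 1 / 2 * (1 / v - 1 / (v + N)) := by
  induction N with
  | zero => simp
  | succ N ih =>
    rw [Finset.sum_range_succ, Finset.sum_range_succ, ih, trapezoidErrorInv]
    push_cast
    rw [← add_assoc]
    ring

theorem sum_range_trapezoidErrorLog (v : ℂ) (N : ℕ) :
    ∑ k ∈ Finset.range N, trapezoidErrorLog (v + k)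
      = logPrimitive (v + N) - logPrimitive v - ∑ k ∈ Finset.range N, Complex.log (v + (k + 1))
        - 1 / 2 * (Complex.log v - Complex.log (v + N)) := by
  induction N with
  | zero => simp
  | succ N ih =>
    rw [Finset.sum_range_succ, Finset.sum_range_succ, ih, trapezoidErrorLog]
    push_cast
    rw [← add_assoc]
    ring

theorem tendsto_sum_range_of_norm_le_one_div_pow {F : ℂ → ℂ} {p : ℕ} (hp : 2 ≤ p)
    (hF : ∀ (w : ℂ) (m : ℝ), 0 < m → (∀ t ∈ Set.Icc (0 : ℝ) 1, w + t ∈ Complex.slitPlane) →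
      (∀ t ∈ Set.Icc (0 : ℝ) 1, m ≤ ‖w + t‖) → ‖F w‖ ≤ 1 / m ^ p)
    {w : ℂ} (hw : w ∈ Complex.slitPlane) :
    Tendsto (fun N : ℕ => ∑ k ∈ Finset.range N, F (N * w + k)) atTop (𝓝 0) := by
  obtain ⟨c, hc, h⟩ := exists_forall_mul_add_le_norm hw
  have hlim : Tendsto (fun N : ℕ => 1 / c ^ p * (1 / (N : ℝ))) atTop (𝓝 0) := by
    simpa using (tendsto_one_div_atTop_nhds_zero_nat (𝕜 := ℝ)).const_mul (1 / c ^ p)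
  refine squeeze_zero_norm' ?_ hlim
  filter_upwards [eventually_ge_atTop 1] with N hN
  have hN1 : (1 : ℝ) ≤ N := by exact_mod_cast hN
  have hN0 : (0 : ℝ) < N := by linarith
  have hterm (k : ℕ) : ‖F (N * w + k)‖ ≤ 1 / (c * N) ^ p := by
    refine hF _ _ (by positivity) (fun t ht => ?_) (fun t ht => ?_)
    · have h1 : (0 : ℝ) ≤ k + t := add_nonneg (Nat.cast_nonneg k) ht.1
      have := Complex.ofReal_mul_add_ofReal_mem_slitPlane hw hN0.le h1 (by linarith)
      push_cast at this
      rwa [add_assoc]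
    · have h1 : (0 : ℝ) ≤ k + t := add_nonneg (Nat.cast_nonneg k) ht.1
      have := h N (k + t) hN0.le h1
      push_cast at this
      rw [add_assoc]
      exact le_trans (by gcongr; linarith) this
  calc ‖∑ k ∈ Finset.range N, F (N * w + k)‖ ≤ ∑ k ∈ Finset.range N, 1 / (c * (N : ℝ)) ^ p :=
        norm_sum_le_of_le _ fun k _ => hterm k
    _ = 1 / c ^ p * (N / (N : ℝ) ^ p) := by
        rw [Finset.sum_const, Finset.card_range, nsmul_eq_mul, mul_pow]
        field_simp
    _ ≤ 1 / c ^ p * (1 / (N : ℝ)) := by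
        refine mul_le_mul_of_nonneg_left ?_ (by positivity)
        rw [div_le_div_iff₀ (by positivity) hN0, one_mul, ← sq]
        exact pow_le_pow_right₀ hN1 hp

theorem log_natCast_mul {w : ℂ} (hw : w ≠ 0) {N : ℕ} (hN : 0 < N) :
    Complex.log (N * w) = Complex.log N + Complex.log w := by
  have := Complex.log_ofReal_mul (r := N) (by exact_mod_cast hN) hw
  rwa [Complex.ofReal_natCast, Complex.natCast_log] at this

theorem add_one_ne_zero_of_mem_slitPlane {w : ℂ} (hw : w ∈ Complex.slitPlane) : w + 1 ≠ 0 :=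
  Complex.slitPlane_ne_zero (by
    simpa using Complex.ofReal_mul_add_ofReal_mem_slitPlane hw zero_le_one zero_le_one
      (by norm_num))

theorem tendsto_sum_range_one_div_natCast_mul_add {w : ℂ} (hw : w ∈ Complex.slitPlane) :
    Tendsto (fun N : ℕ => ∑ k ∈ Finset.range N, 1 / ((N : ℂ) * w + (k + 1))) atTop
      (𝓝 (Complex.log (w + 1) - Complex.log w)) := by
  have hw0 := Complex.slitPlane_ne_zero hw
  have hw1 := add_one_ne_zero_of_mem_slitPlane hw
  have hE := tendsto_sum_range_of_norm_le_one_div_pow (p := 3) (by norm_num)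
    (fun v m hm hs hb => (norm_trapezoidErrorInv_le hm hs hb).trans
      (one_div_le_one_div_of_le (by positivity) (by linarith [pow_pos hm 3]))) hw
  have h := ((tendsto_const_nhds (x := Complex.log (w + 1) - Complex.log w)).sub hE).sub
    ((tendsto_one_div_atTop_nhds_zero_nat (𝕜 := ℂ)).mul_const (1 / 2 * (1 / w - 1 / (w + 1))))
  rw [sub_zero, zero_mul, sub_zero] at h
  refine h.congr' ?_
  filter_upwards [eventually_gt_atTop 0] with N hN
  have hN0 : (N : ℂ) ≠ 0 := by exact_mod_cast hN.ne'
  rw [sum_range_trapezoidErrorInv, show (N : ℂ) * w + N = N * (w + 1) by ring,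
    log_natCast_mul hw0 hN, log_natCast_mul hw1 hN, ← one_div_mul_one_div, ← one_div_mul_one_div]
  ring

theorem tendsto_sum_range_log_natCast_mul_add {w : ℂ} (hw : w ∈ Complex.slitPlane) :
    Tendsto (fun N : ℕ => ∑ k ∈ Finset.range N, Complex.log ((N : ℂ) * w + (k + 1))
        - (N * Complex.log N - N + N * ((w + 1) * Complex.log (w + 1) - w * Complex.log w))) atTop
      (𝓝 (1 / 2 * (Complex.log (w + 1) - Complex.log w))) := by
  have hw0 := Complex.slitPlane_ne_zero hw
  have hw1 := add_one_ne_zero_of_mem_slitPlane hw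
  have hE := tendsto_sum_range_of_norm_le_one_div_pow le_rfl
    (fun v m hm hs hb => norm_trapezoidErrorLog_le hm hs hb) hw
  have h := (tendsto_const_nhds (x := 1 / 2 * (Complex.log (w + 1) - Complex.log w))).sub hE
  rw [sub_zero] at h
  refine h.congr' ?_
  filter_upwards [eventually_gt_atTop 0] with N hN
  rw [sum_range_trapezoidErrorLog, show (N : ℂ) * w + N = N * (w + 1) by ring,
    logPrimitive, logPrimitive, log_natCast_mul hw0 hN, log_natCast_mul hw1 hN]
  ring

theorem tendsto_sum_range_log_natCast :
    Tendsto (fun N : ℕ => ∑ k ∈ Finset.range N, Complex.log ((k : ℂ) + 1)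
        - (N * Complex.log N - N + 1 / 2 * Complex.log N)) atTop
      (𝓝 (1 / 2 * Complex.log (2 * π))) := by
  have h := (Stirling.tendsto_stirlingSeq_sqrt_pi.log (by positivity)).add_const
    (1 / 2 * Real.log 2)
  have hlim : Real.log √π + 1 / 2 * Real.log 2 = 1 / 2 * Real.log (2 * π) := by
    rw [Real.log_sqrt Real.pi_pos.le, Real.log_mul two_ne_zero Real.pi_ne_zero]
    ring
  rw [hlim] at h
  have hc := (Complex.continuous_ofReal.tendsto _).comp h
  have hlim' : ((1 / 2 * Real.log (2 * π) : ℝ) : ℂ) = 1 / 2 * Complex.log (2 * π) := by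
    rw [Complex.ofReal_mul, Complex.ofReal_log (by positivity)]
    push_cast
    rfl
  rw [hlim'] at hc
  refine hc.congr' ?_
  filter_upwards [eventually_gt_atTop 0] with N hN
  have hN0 : (N : ℝ) ≠ 0 := by exact_mod_cast hN.ne'
  have hsum : ∑ k ∈ Finset.range N, Complex.log ((k : ℂ) + 1)
      = (Real.log (N.factorial : ℝ) : ℝ) := by
    rw [← Finset.prod_range_add_one_eq_factorial, Nat.cast_prod,
      Real.log_prod (fun k _ => by positivity), Complex.ofReal_sum]
    refine Finset.sum_congr rfl fun k _ => ?_
    rw [Complex.ofReal_log (by positivity)]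
    push_cast
    rfl
  rw [hsum, Complex.natCast_log, Function.comp_apply, Stirling.log_stirlingSeq_formula,
    Real.log_mul two_ne_zero hN0, Real.log_div hN0 (Real.exp_pos 1).ne', Real.log_exp]
  push_cast
  ring

theorem tendsto_sum_range_one_div_natCast_sub_log :
    Tendsto (fun N : ℕ => ∑ k ∈ Finset.range N, 1 / ((k : ℂ) + 1) - Complex.log N) atTop
      (𝓝 (Real.eulerMascheroniConstant : ℂ)) := by
  refine ((Complex.continuous_ofReal.tendsto _).comp Real.tendsto_harmonic_sub_log).congr
    fun N => ?_
  simp [harmonic, Complex.natCast_log]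

theorem sum_sum_trapezoidErrorInv_eq {z : ℂ} (hz : z ∈ Complex.slitPlane) {N : ℕ} (hN : 0 < N) :
    ∑ n ∈ Finset.range N, ∑ k ∈ Finset.range N, trapezoidErrorInv ((n + 1) * z + k)
      = ∑ n ∈ Finset.range N, Complex.log (N * z⁻¹ + (n + 1))
        - ∑ n ∈ Finset.range N, Complex.log ((n : ℂ) + 1)
        - z⁻¹ / 2 * ∑ n ∈ Finset.range N, 1 / ((n : ℂ) + 1)
        + z⁻¹ / 2 * ∑ n ∈ Finset.range N, 1 / (N * z⁻¹ + (n + 1))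
        - ∑ n ∈ Finset.range N, ∑ k ∈ Finset.range N, 1 / ((n + 1) * z + (k + 1)) := by
  have hz0 := Complex.slitPlane_ne_zero hz
  simp only [Finset.mul_sum, ← Finset.sum_sub_distrib, ← Finset.sum_add_distrib]
  refine Finset.sum_congr rfl fun n _ => ?_
  have hlog := log_ofReal_div_add_ofReal hz (x := N) (y := n + 1) (by exact_mod_cast hN)
    (by positivity)
  have hlog' := log_natCast_mul hz0 n.succ_pos
  have hne := Complex.slitPlane_ne_zero (Complex.ofReal_mul_add_ofReal_mem_slitPlane hz
    (x := n + 1) (y := N) (by positivity) (by positivity) (by positivity))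
  push_cast at hlog hlog' hne
  rw [sum_range_trapezoidErrorInv, hlog', ← div_eq_mul_inv, hlog, add_comm (N : ℂ)]
  have hn : (n : ℂ) + 1 ≠ 0 := Nat.cast_add_one_ne_zero n
  have e : (N : ℂ) / z + (n + 1) = ((n + 1) * z + N) / z := by field_simp; ring
  rw [e]
  field_simp
  ring

theorem sum_sum_one_div_inv {z : ℂ} (hz : z ≠ 0) (N : ℕ) :
    ∑ n ∈ Finset.range N, ∑ k ∈ Finset.range N, 1 / (((n : ℂ) + 1) * z⁻¹ + (k + 1))
      = z * ∑ n ∈ Finset.range N, ∑ k ∈ Finset.range N, 1 / (((n : ℂ) + 1) * z + (k + 1)) := by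
  rw [Finset.sum_comm]
  simp only [Finset.mul_sum]
  refine Finset.sum_congr rfl fun n _ => Finset.sum_congr rfl fun k _ => ?_
  rw [show ((k : ℂ) + 1) * z⁻¹ + (n + 1) = ((n + 1) * z + (k + 1)) / z by field_simp; ring,
    one_div_div, div_eq_mul_one_div]

theorem tsum_digammaRemainder_sub {z : ℂ} (hz : z ∈ Complex.slitPlane) :
    ∑' n : ℕ, digammaRemainder ((n + 1) * z)
        - z⁻¹ * ∑' n : ℕ, digammaRemainder ((n + 1) * z⁻¹)
      = 1 / 2 * (Real.eulerMascheroniConstant - (Complex.log (2 * π) - Complex.log z))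
        - z⁻¹ / 2 * (Real.eulerMascheroniConstant - (Complex.log (2 * π) + Complex.log z)) := by
  have hz0 := Complex.slitPlane_ne_zero hz
  have hzi := inv_mem_slitPlane hz
  have hleft := (tendsto_sum_sum_trapezoidErrorInv hz).sub
    ((tendsto_sum_sum_trapezoidErrorInv hzi).const_mul z⁻¹)
  have hinv : Complex.log z⁻¹ = -Complex.log z :=
    Complex.log_inv _ (Complex.slitPlane_arg_ne_pi hz)
  have hinv1 : Complex.log (z⁻¹ + 1) = Complex.log (z + 1) - Complex.log z := by
    simpa [add_comm] using log_ofReal_div_add_ofReal hz one_pos zero_le_one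
  have hright := ((((tendsto_sum_range_log_natCast_mul_add hzi).sub
    ((tendsto_sum_range_log_natCast_mul_add hz).const_mul z⁻¹)).sub
    (tendsto_sum_range_log_natCast.const_mul (1 - z⁻¹))).add
    (tendsto_sum_range_one_div_natCast_sub_log.const_mul ((1 - z⁻¹) / 2))).add
    (((tendsto_sum_range_one_div_natCast_mul_add hzi).const_mul (z⁻¹ / 2)).sub
    ((tendsto_sum_range_one_div_natCast_mul_add hz).const_mul (1 / 2)))
  have heq := tendsto_nhds_unique (hleft.congr' ?_) hright
  · rw [heq, hinv, hinv1]
    ring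
  · filter_upwards [eventually_gt_atTop 0] with N hN
    rw [sum_sum_trapezoidErrorInv_eq hz hN, sum_sum_trapezoidErrorInv_eq hzi hN,
      sum_sum_one_div_inv hz0, inv_inv, hinv, hinv1]
    field_simp
    ring

theorem guinand_transformation_complex (z : ℂ) (hz : z ≠ 0)
    (harg : |z.arg| < π) :
    Summable (fun n : ℕ =>
      cdigamma ((n + 1) * z) - Complex.log ((n + 1) * z) + 1 / (2 * (n + 1) * z)) ∧
    Summable (fun n : ℕ =>
      cdigamma ((n + 1) / z) - Complex.log ((n + 1) / z) + z / (2 * (n + 1))) ∧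
    (∑' n : ℕ,
        (cdigamma ((n + 1) * z) - Complex.log ((n + 1) * z) + 1 / (2 * (n + 1) * z)))
        + (1 / (2 * z)) *
            ((Real.eulerMascheroniConstant : ℂ) - Complex.log (2 * π * z))
      = (1 / z) * (∑' n : ℕ,
          (cdigamma ((n + 1) / z) - Complex.log ((n + 1) / z) + z / (2 * (n + 1))))
        + (1 / 2) *
            ((Real.eulerMascheroniConstant : ℂ) - Complex.log (2 * π / z)) := by
  have hzs : z ∈ Complex.slitPlane :=
    Complex.mem_slitPlane_iff_arg.2 ⟨(lt_of_abs_lt harg).ne, hz⟩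
  have h1 (n : ℕ) : cdigamma ((n + 1) * z) - Complex.log ((n + 1) * z) + 1 / (2 * (n + 1) * z)
      = digammaRemainder ((n + 1) * z) := by
    rw [digammaRemainder, mul_assoc 2]
  have h2 (n : ℕ) : cdigamma ((n + 1) / z) - Complex.log ((n + 1) / z) + z / (2 * (n + 1))
      = digammaRemainder ((n + 1) * z⁻¹) := by
    rw [digammaRemainder, ← div_eq_mul_inv, ← mul_div_assoc, one_div_div]
  have hpi : (0 : ℝ) < 2 * π := by positivity
  have hlog (w : ℂ) (hw : w ≠ 0) :
      Complex.log (2 * π * w) = Complex.log (2 * π) + Complex.log w := by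
    have := Complex.log_ofReal_mul hpi hw
    rw [Complex.ofReal_log hpi.le] at this
    push_cast at this
    exact this
  simp only [h1, h2]
  refine ⟨(hasSum_digammaRemainder hzs).summable,
    (hasSum_digammaRemainder (inv_mem_slitPlane hzs)).summable, ?_⟩
  rw [hlog z hz, div_eq_mul_inv (2 * (π : ℂ)), hlog _ (inv_ne_zero hz),
    Complex.log_inv _ (Complex.slitPlane_arg_ne_pi hzs), one_div z,
    show 1 / (2 * z) = z⁻¹ / 2 by field_simp]
  linear_combination tsum_digammaRemainder_sub hzs
end

section
/- For every real a > 0, the improper integral ∫_0^∞ ( 1/(u(e^u - 1)) - 1/u² + e^{-ua}/(2u) ) du converges and equals -(1/2) log(2πa). -/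
open Real MeasureTheory Filter

section AuxiliaryIntegrals

open Set Topology

/-- The integrand of `integral_eq_neg_half_log_two_pi_a`. -/
noncomputable def binetIntegrand (a u : ℝ) : ℝ :=
  1 / (u * (Real.exp u - 1)) - 1 / u ^ 2 + Real.exp (-(u * a)) / (2 * u)

lemma measurable_binetIntegrand (a : ℝ) : Measurable (binetIntegrand a) := by
  unfold binetIntegrand
  fun_prop

lemma abs_binet_kernel_le_one {u : ℝ} (h0 : 0 < u) (h1 : u ≤ 1) :
    |1 / (u * (Real.exp u - 1)) - 1 / u ^ 2 + 1 / (2 * u)| ≤ 1 := by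
  have hlow := Real.quadratic_le_exp_of_nonneg h0.le
  have hup := Real.exp_bound' h0.le h1 (n := 3) (by norm_num)
  norm_num [Finset.sum_range_succ, Nat.factorial] at hup
  have hE : 0 < Real.exp u - 1 := by nlinarith
  have hu2 : 0 < u ^ 2 := by positivity
  have hu3 : 0 < u ^ 3 := by positivity
  have hden : 0 < 2 * u ^ 2 * (Real.exp u - 1) := by positivity
  have heq : 1 / (u * (Real.exp u - 1)) - 1 / u ^ 2 + 1 / (2 * u)
      = (2 * u - 2 * (Real.exp u - 1) + u * (Real.exp u - 1))
        / (2 * u ^ 2 * (Real.exp u - 1)) := by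
    have := hE.ne'
    field_simp
  rw [heq, abs_div, abs_of_pos hden, div_le_one hden]
  have hden' : 2 * u ^ 3 ≤ 2 * u ^ 2 * (Real.exp u - 1) := by
    have := mul_le_mul_of_nonneg_left (show u ≤ Real.exp u - 1 by nlinarith) hu2.le
    nlinarith
  refine le_trans ?_ hden'
  obtain ⟨r, hr⟩ : ∃ r, r = Real.exp u - (1 + u + u ^ 2 / 2) := ⟨_, rfl⟩
  have hr0 : 0 ≤ r := by linarith
  have hr1 : r ≤ u ^ 3 / 2 := by nlinarith
  have hexp : Real.exp u = 1 + u + u ^ 2 / 2 + r := by linarith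
  rw [hexp, abs_le]
  constructor <;> nlinarith [mul_nonneg h0.le hr0]

lemma abs_binetIntegrand_le_of_le_one {a u : ℝ} (ha : 0 < a) (h0 : 0 < u) (h1 : u ≤ 1) :
    |binetIntegrand a u| ≤ 1 + a := by
  have hk := abs_binet_kernel_le_one h0 h1
  have heq : binetIntegrand a u = (1 / (u * (Real.exp u - 1)) - 1 / u ^ 2 + 1 / (2 * u))
      - (1 - Real.exp (-(u * a))) / (2 * u) := by
    unfold binetIntegrand
    ring
  have h2 : 0 ≤ (1 - Real.exp (-(u * a))) / (2 * u) :=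
    div_nonneg (sub_nonneg.2 (Real.exp_le_one_iff.2 (by nlinarith))) (by positivity)
  have h3 : (1 - Real.exp (-(u * a))) / (2 * u) ≤ a := by
    rw [div_le_iff₀ (by positivity)]
    nlinarith [Real.add_one_le_exp (-(u * a)), mul_pos h0 ha]
  rw [heq]
  rw [abs_le] at hk ⊢
  constructor <;> linarith

lemma abs_binetIntegrand_le_of_one_le {a u : ℝ} (h1 : 1 ≤ u) :
    |binetIntegrand a u| ≤ u ^ (-2 : ℝ) + Real.exp (-a * u) := by
  have h0 : 0 < u := by linarith
  have hE : u ≤ Real.exp u - 1 := by linarith [Real.add_one_le_exp u]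
  have h2 : 0 ≤ 1 / (u * (Real.exp u - 1)) := by
    have : 0 < Real.exp u - 1 := by linarith
    positivity
  have h3 : 1 / (u * (Real.exp u - 1)) ≤ 1 / u ^ 2 := by
    apply one_div_le_one_div_of_le (by positivity)
    nlinarith
  have h4 : u ^ (-2 : ℝ) = 1 / u ^ 2 := by
    rw [Real.rpow_neg h0.le, one_div]
    norm_num
  have h5 : Real.exp (-(u * a)) / (2 * u) ≤ Real.exp (-a * u) := by
    rw [show -a * u = -(u * a) by ring]
    exact div_le_self (Real.exp_pos _).le (by linarith)
  have h6 : 0 ≤ Real.exp (-(u * a)) / (2 * u) := by positivity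
  rw [h4, binetIntegrand, abs_le]
  constructor <;> linarith

lemma integrableOn_binetIntegrand {a : ℝ} (ha : 0 < a) :
    IntegrableOn (binetIntegrand a) (Ioi 0) := by
  rw [← Ioc_union_Ioi_eq_Ioi zero_le_one, integrableOn_union]
  constructor
  · refine Measure.integrableOn_of_bounded (M := 1 + a) (by simp)
      (measurable_binetIntegrand a).aestronglyMeasurable ?_
    filter_upwards [ae_restrict_mem measurableSet_Ioc] with u hu
    exact abs_binetIntegrand_le_of_le_one ha hu.1 hu.2
  · refine Integrable.mono' ((integrableOn_Ioi_rpow_of_lt (by norm_num : (-2 : ℝ) < -1) one_pos).add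
      (exp_neg_integrableOn_Ioi 1 ha)) (measurable_binetIntegrand a).aestronglyMeasurable ?_
    filter_upwards [ae_restrict_mem measurableSet_Ioi] with u hu
    exact abs_binetIntegrand_le_of_one_le (le_of_lt hu)

lemma integrableOn_exp_sub_exp_div {c d : ℝ} (hc : 0 < c) (hcd : c ≤ d) :
    IntegrableOn (fun u : ℝ => u⁻¹ • (Real.exp (-(c * u)) - Real.exp (-(d * u)))) (Ioi 0) := by
  refine Integrable.mono' ((exp_neg_integrableOn_Ioi 0 hc).const_mul (d - c))
    (by fun_prop) ?_
  filter_upwards [ae_restrict_mem measurableSet_Ioi] with u hu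
  have hu : 0 < u := hu
  have hfac : Real.exp (-(d * u)) = Real.exp (-c * u) * Real.exp (-((d - c) * u)) := by
    rw [← Real.exp_add]
    ring_nf
  have h1 := Real.add_one_le_exp (-((d - c) * u))
  have h2 : Real.exp (-((d - c) * u)) ≤ 1 :=
    Real.exp_le_one_iff.2 (by nlinarith [mul_nonneg (sub_nonneg.2 hcd) hu.le])
  have h3 := Real.exp_pos (-c * u)
  rw [hfac, show -(c * u) = -c * u by ring, smul_eq_mul, Real.norm_eq_abs, abs_of_nonneg,
    inv_mul_le_iff₀ hu]
  · nlinarith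
  · exact mul_nonneg (inv_nonneg.2 hu.le) (by nlinarith)

lemma integral_exp_sub_exp_div {c d : ℝ} (hc : 0 < c) (hcd : c ≤ d) :
    ∫ u in Ioi (0 : ℝ), u⁻¹ • (Real.exp (-(c * u)) - Real.exp (-(d * u)))
      = Real.log (d / c) := by
  have hcont : Continuous fun x : ℝ => Real.exp (-x) := by fun_prop
  have h := Frullani.integral_Ioi_eq (f := fun x : ℝ => Real.exp (-x)) (L := 1) (R := 0)
    (hcont.locallyIntegrable.locallyIntegrableOn _) hc (hc.trans_le hcd)
    ((by simpa using hcont.tendsto 0 : Tendsto _ (𝓝 (0 : ℝ)) (𝓝 (1 : ℝ))).mono_left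
      nhdsWithin_le_nhds)
    Real.tendsto_exp_neg_atTop_nhds_zero (integrableOn_exp_sub_exp_div hc hcd)
  simpa using h

lemma integrableOn_and_integral_exp_div_sub {c : ℝ} (hc : 0 < c) :
    IntegrableOn (fun u : ℝ => c * Real.exp (-(c * u)) / u
      - (1 - Real.exp (-(c * u))) / u ^ 2) (Ioi 0) ∧
    ∫ u in Ioi (0 : ℝ), (c * Real.exp (-(c * u)) / u - (1 - Real.exp (-(c * u))) / u ^ 2)
      = -c := by
  let φ : ℝ → ℝ := fun u => 1 - Real.exp (-(c * u))
  have hφ (u : ℝ) : HasDerivAt φ (c * Real.exp (-(c * u))) u := by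
    have := (((hasDerivAt_id u).const_mul c).neg.exp).const_sub 1
    refine this.congr_deriv ?_
    simp
    ring
  have heq {u : ℝ} (hu : u ≠ 0) : dslope φ 0 u = φ u / u := by
    rw [dslope_of_ne _ hu, slope_def_field]
    simp [φ]
  have hzero : dslope φ 0 0 = c := by
    rw [dslope_same, (hφ 0).deriv]
    simp
  have hcont : ContinuousWithinAt (dslope φ 0) (Ici 0) 0 :=
    (continuousAt_dslope_same.2 (hφ 0).differentiableAt).continuousWithinAt
  have hderiv : ∀ u ∈ Ioi (0 : ℝ), HasDerivAt (dslope φ 0)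
      (c * Real.exp (-(c * u)) / u - (1 - Real.exp (-(c * u))) / u ^ 2) u := by
    intro u hu
    have hu : 0 < u := hu
    have h := (hφ u).div (hasDerivAt_id u) hu.ne'
    have h' : HasDerivAt (dslope φ 0) _ u := h.congr_of_eventuallyEq <| by
      filter_upwards [eventually_ne_nhds hu.ne'] with x hx
      exact heq hx
    convert h' using 1
    simp only [φ, id]
    field_simp
  have hneg : ∀ u ∈ Ioi (0 : ℝ),
      c * Real.exp (-(c * u)) / u - (1 - Real.exp (-(c * u))) / u ^ 2 ≤ 0 := by
    intro u hu
    have hu : 0 < u := hu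
    have h1 := Real.add_one_le_exp (c * u)
    have h2 : Real.exp (-(c * u)) * Real.exp (c * u) = 1 := by
      rw [← Real.exp_add]
      simp
    have h3 : Real.exp (-(c * u)) * (c * u + 1) ≤ 1 :=
      (mul_le_mul_of_nonneg_left h1 (Real.exp_pos _).le).trans_eq h2
    rw [show c * Real.exp (-(c * u)) / u - (1 - Real.exp (-(c * u))) / u ^ 2
      = (Real.exp (-(c * u)) * (c * u + 1) - 1) / u ^ 2 by field_simp; ring]
    exact div_nonpos_of_nonpos_of_nonneg (by linarith) (by positivity)
  have hlim : Tendsto (dslope φ 0) atTop (𝓝 0) := by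
    refine tendsto_of_tendsto_of_tendsto_of_le_of_le' tendsto_const_nhds
      tendsto_inv_atTop_zero ?_ ?_
    all_goals
      filter_upwards [eventually_gt_atTop 0] with u hu
      have h1 : Real.exp (-(c * u)) ≤ 1 := Real.exp_le_one_iff.2 (by nlinarith)
      rw [heq hu.ne']
    · exact div_nonneg (by simpa [φ] using h1) hu.le
    · rw [div_eq_mul_inv]
      exact mul_le_of_le_one_left (by positivity) (by simp [φ, Real.exp_nonneg])
  refine ⟨integrableOn_Ioi_deriv_of_nonpos hcont hderiv hneg hlim, ?_⟩
  rw [integral_Ioi_of_hasDerivAt_of_nonpos hcont hderiv hneg hlim, hzero, zero_sub]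

lemma sum_exp_neg_mul_eq {u : ℝ} (hu : 0 < u) (n : ℕ) :
    ∑ k ∈ Finset.range n, Real.exp (-((k + 1 : ℝ) * u))
      = (1 - Real.exp (-(n * u))) / (Real.exp u - 1) := by
  have hE : Real.exp u - 1 ≠ 0 := (sub_pos.2 (Real.one_lt_exp_iff.2 hu)).ne'
  induction n with
  | zero => simp
  | succ n ih =>
    have h : Real.exp (-(n * u)) = Real.exp (-((n + 1 : ℝ) * u)) * Real.exp u := by
      rw [← Real.exp_add]
      ring_nf
    rw [Finset.sum_range_succ, ih, h]
    push_cast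
    field_simp
    ring

lemma binetIntegrand_sub_exp_mul {a u : ℝ} (hu : 0 < u) (n : ℕ) :
    binetIntegrand a u - Real.exp (-(n * u)) * binetIntegrand a u
      = (∑ k ∈ Finset.range n,
          u⁻¹ • (Real.exp (-((k + 1 : ℝ) * u)) - Real.exp (-(n * u))))
        + (n * Real.exp (-(n * u)) / u - (1 - Real.exp (-(n * u))) / u ^ 2)
        + 1 / 2 * u⁻¹ • (Real.exp (-(a * u)) - Real.exp (-((a + n) * u))) := by
  have hE : Real.exp u - 1 ≠ 0 := (sub_pos.2 (Real.one_lt_exp_iff.2 hu)).ne'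
  have hsplit : Real.exp (-((a + n) * u)) = Real.exp (-(a * u)) * Real.exp (-(n * u)) := by
    rw [← Real.exp_add]
    ring_nf
  rw [← Finset.smul_sum, Finset.sum_sub_distrib, sum_exp_neg_mul_eq hu, hsplit, binetIntegrand,
    mul_comm u a]
  simp only [Finset.sum_const, Finset.card_range, nsmul_eq_mul, smul_eq_mul]
  field_simp
  ring

lemma integral_binetIntegrand_sub_exp_mul {a : ℝ} (ha : 0 < a) {n : ℕ} (hn : n ≠ 0) :
    ∫ u in Ioi (0 : ℝ), (binetIntegrand a u - Real.exp (-(n * u)) * binetIntegrand a u)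
      = n * Real.log n - Real.log n.factorial - n + 1 / 2 * Real.log ((a + n) / a) := by
  have hn0 : (0 : ℝ) < n := by exact_mod_cast Nat.pos_of_ne_zero hn
  have hle {k : ℕ} (hk : k ∈ Finset.range n) : (k + 1 : ℝ) ≤ n := by
    exact_mod_cast Finset.mem_range.1 hk
  have hsum : IntegrableOn (fun u : ℝ => ∑ k ∈ Finset.range n,
      u⁻¹ • (Real.exp (-((k + 1 : ℝ) * u)) - Real.exp (-(n * u)))) (Ioi 0) :=
    integrable_finsetSum _ fun k hk => integrableOn_exp_sub_exp_div (by positivity) (hle hk)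
  obtain ⟨hmid, hmid'⟩ := integrableOn_and_integral_exp_div_sub hn0
  have hlast := (integrableOn_exp_sub_exp_div ha (by linarith : a ≤ a + n)).const_mul (1 / 2)
  rw [setIntegral_congr_fun measurableSet_Ioi fun u hu => binetIntegrand_sub_exp_mul hu n,
    integral_add (by exact hsum.add hmid) hlast, integral_add hsum hmid, hmid', integral_const_mul,
    integral_exp_sub_exp_div ha (by linarith), integral_finsetSum _ fun k hk =>
      integrableOn_exp_sub_exp_div (by positivity) (hle hk),
    Finset.sum_congr rfl fun k hk => integral_exp_sub_exp_div (by positivity) (hle hk),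
    Finset.sum_congr rfl fun (k : ℕ) _ =>
      Real.log_div hn0.ne' (by positivity : (k + 1 : ℝ) ≠ 0),
    Finset.sum_sub_distrib, ← Real.log_prod (f := fun k : ℕ => (k + 1 : ℝ)) fun k _ => by positivity,
    ← Finset.prod_range_add_one_eq_factorial]
  push_cast
  simp
  ring

lemma norm_exp_mul_binetIntegrand_le (a : ℝ) (n : ℕ) :
    ∀ᵐ u ∂volume.restrict (Ioi (0 : ℝ)),
      ‖Real.exp (-(n * u)) * binetIntegrand a u‖ ≤ ‖binetIntegrand a u‖ := by
  filter_upwards [ae_restrict_mem measurableSet_Ioi] with u hu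
  have hu : 0 < u := hu
  rw [norm_mul]
  refine mul_le_of_le_one_left (norm_nonneg _) ?_
  rw [Real.norm_eq_abs, Real.abs_exp]
  exact Real.exp_le_one_iff.2 (neg_nonpos.2 (by positivity))

lemma tendsto_integral_exp_mul_binetIntegrand {a : ℝ} (ha : 0 < a) :
    Tendsto (fun n : ℕ => ∫ u in Ioi (0 : ℝ), Real.exp (-(n * u)) * binetIntegrand a u)
      atTop (𝓝 0) := by
  have hmeas := measurable_binetIntegrand a
  have h : Tendsto (fun n : ℕ => ∫ u in Ioi (0 : ℝ), Real.exp (-(n * u)) * binetIntegrand a u)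
      atTop (𝓝 (∫ _ in Ioi (0 : ℝ), (0 : ℝ))) := by
    refine tendsto_integral_of_dominated_convergence (fun u => ‖binetIntegrand a u‖)
      (fun n => by fun_prop) (integrableOn_binetIntegrand ha).norm (fun n => ?_) ?_
    · exact norm_exp_mul_binetIntegrand_le a n
    · filter_upwards [ae_restrict_mem measurableSet_Ioi] with u hu
      simpa using (Real.tendsto_exp_neg_atTop_nhds_zero.comp
        (tendsto_natCast_atTop_atTop.atTop_mul_const hu)).mul_const (binetIntegrand a u)
  simpa using h

lemma tendsto_log_stirling_add {a : ℝ} (ha : 0 < a) :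
    Tendsto (fun n : ℕ => n * Real.log n - Real.log n.factorial - n
        + 1 / 2 * Real.log ((a + n) / a)) atTop (𝓝 (-(1 / 2) * Real.log (2 * π * a))) := by
  have hπ : (0 : ℝ) < √π := by positivity
  have h1 : Tendsto (fun n : ℕ => Real.log (Stirling.stirlingSeq n)) atTop
      (𝓝 (Real.log √π)) :=
    Stirling.tendsto_stirlingSeq_sqrt_pi.log hπ.ne'
  have h2 : Tendsto (fun n : ℕ => Real.log (a / n + 1)) atTop (𝓝 0) := by
    have := ((tendsto_const_div_atTop_nhds_zero_nat a).add_const 1).log (by norm_num)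
    simpa using this
  have h3 := (h1.neg.add (h2.const_mul (1 / 2))).sub_const (1 / 2 * Real.log (2 * a))
  have hval : -Real.log √π + 1 / 2 * 0 - 1 / 2 * Real.log (2 * a)
      = -(1 / 2) * Real.log (2 * π * a) := by
    rw [Real.log_sqrt pi_pos.le, show 2 * π * a = π * (2 * a) by ring,
      Real.log_mul pi_pos.ne' (by positivity)]
    ring
  rw [hval] at h3
  refine h3.congr' ?_
  filter_upwards [eventually_ne_atTop 0] with n hn
  have hn0 : (0 : ℝ) < n := by exact_mod_cast Nat.pos_of_ne_zero hn
  have hfrac : a / n + 1 = (a + n) / n := by field_simp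
  rw [Stirling.log_stirlingSeq_formula, hfrac, Real.log_div (by positivity) hn0.ne',
    Real.log_div (by positivity) ha.ne', Real.log_mul two_ne_zero hn0.ne',
    Real.log_mul two_ne_zero ha.ne', Real.log_div hn0.ne' (Real.exp_ne_zero _), Real.log_exp]
  ring

lemma integral_binetIntegrand {a : ℝ} (ha : 0 < a) :
    ∫ u in Ioi (0 : ℝ), binetIntegrand a u = -(1 / 2) * Real.log (2 * π * a) := by
  have hint := integrableOn_binetIntegrand ha
  have hmul (n : ℕ) :
      IntegrableOn (fun u => Real.exp (-(n * u)) * binetIntegrand a u) (Ioi 0) := by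
    have hmeas := measurable_binetIntegrand a
    exact hint.norm.mono' (by fun_prop) (norm_exp_mul_binetIntegrand_le a n)
  have hlim := (tendsto_integral_exp_mul_binetIntegrand ha).const_sub
    (∫ u in Ioi (0 : ℝ), binetIntegrand a u)
  rw [sub_zero] at hlim
  refine tendsto_nhds_unique hlim ((tendsto_log_stirling_add ha).congr' ?_)
  filter_upwards [eventually_ne_atTop 0] with n hn
  rw [← integral_binetIntegrand_sub_exp_mul ha hn, integral_sub hint (hmul n)]

end AuxiliaryIntegrals

theorem integral_eq_neg_half_log_two_pi_a (a : ℝ) (ha : 0 < a) :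
    IntegrableOn
      (fun u : ℝ => 1 / (u * (Real.exp u - 1)) - 1 / u ^ 2 + Real.exp (-(u * a)) / (2 * u))
      (Set.Ioi (0 : ℝ)) ∧
    ∫ u in Set.Ioi (0 : ℝ),
        (1 / (u * (Real.exp u - 1)) - 1 / u ^ 2 + Real.exp (-(u * a)) / (2 * u))
      = -(1 / 2) * Real.log (2 * π * a) :=
  ⟨integrableOn_binetIntegrand ha, integral_binetIntegrand ha⟩
end

section
/- Let Ξ(t) := ξ(1/2 + it), where ξ(s) := (s-1) π^{-s/2} Γ(1 + s/2) ζ(s). Then for every real n, ∫_0^∞ |Ξ(t/2) Γ((-1+it)/4)|² · cos(nt)/(1+t²) dt = π^{3/2} ∫_0^∞ ( 1/(e^{x e^n} - 1) - 1/(x e^n) ) ( 1/(e^{x e^{-n}} - 1) - 1/(x e^{-n}) ) dx. -/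
open Real MeasureTheory Filter

/-- `ξ(s) := (s-1) π^{-s/2} Γ(1 + s/2) ζ(s)`. -/
noncomputable def xi (s : ℂ) : ℂ :=
  (s - 1) * (π : ℂ) ^ (-s / 2) * Complex.Gamma (1 + s / 2) * riemannZeta s

/-- Riemann's Ξ-function, `Ξ(t) := ξ(1/2 + it)`. -/
noncomputable def Xi (t : ℝ) : ℂ := xi (1 / 2 + Complex.I * t)

open Set Topology Asymptotics
open scoped FourierTransform Convolution ComplexConjugate

/-- The function `1 / (e ^ x - 1) - 1 / x`. -/
noncomputable def expSubOneInvSubInv (x : ℝ) : ℝ := 1 / (rexp x - 1) - 1 / x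

theorem one_div_exp_sub_one_le {x : ℝ} (hx : 0 < x) : 1 / (rexp x - 1) ≤ 1 / x :=
  one_div_le_one_div_of_le hx (by linarith [Real.add_one_le_exp x])

theorem exp_sub_one_pos {x : ℝ} (hx : 0 < x) : 0 < rexp x - 1 := by
  linarith [Real.add_one_lt_exp hx.ne']

theorem abs_expSubOneInvSubInv_le_inv {x : ℝ} (hx : 0 < x) :
    |expSubOneInvSubInv x| ≤ 1 / x := by
  have h1 := one_div_exp_sub_one_le hx
  have h2 := one_div_pos.mpr (exp_sub_one_pos hx)
  rw [expSubOneInvSubInv, abs_le]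
  constructor <;> linarith

theorem abs_expSubOneInvSubInv_le_one {x : ℝ} (hx : 0 < x) :
    |expSubOneInvSubInv x| ≤ 1 := by
  have h1 := one_div_exp_sub_one_le hx
  have h2 := exp_sub_one_pos hx
  rw [expSubOneInvSubInv, abs_le]
  refine ⟨?_, by linarith⟩
  have h3 : 1 - x ≤ rexp (-x) := by linarith [Real.add_one_le_exp (-x)]
  have h4 : rexp x * rexp (-x) = 1 := by rw [← Real.exp_add]; simp
  have h5 := mul_le_mul_of_nonneg_left h3 (Real.exp_pos x).le
  rw [div_sub_div _ _ h2.ne' hx.ne', le_div_iff₀ (by positivity)]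
  nlinarith

theorem mellin_one_div_exp_sub_one {s : ℂ} (hs : 1 < s.re) :
    mellin (fun t : ℝ ↦ ((1 / (rexp t - 1) : ℝ) : ℂ)) s = Complex.Gamma s * riemannZeta s := by
  have key := hasSum_mellin (a := fun _ : ℕ ↦ 1) (p := fun i : ℕ ↦ (i : ℝ) + 1)
    (F := fun t : ℝ ↦ ((1 / (rexp t - 1) : ℝ) : ℂ)) (s := s) (fun i ↦ Or.inr (by positivity))
    (by linarith) ?_ ?_
  · rw [← key.tsum_eq, zeta_eq_tsum_one_div_nat_add_one_cpow hs, ← tsum_mul_left]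
    refine tsum_congr fun i ↦ ?_
    push_cast
    ring
  · intro t ht
    have ht : 0 < t := ht
    have h1 : rexp (-t) < 1 := by simpa using ht
    have h2 := (hasSum_geometric_of_lt_one (Real.exp_pos (-t)).le h1).mul_left (rexp (-t))
    have h3 : rexp (-t) * (1 - rexp (-t))⁻¹ = 1 / (rexp t - 1) := by
      have := exp_sub_one_pos ht
      rw [Real.exp_neg]
      have h4 := Real.exp_pos t
      field_simp
    rw [h3] at h2
    have h5 := Complex.hasSum_ofReal.mpr h2
    refine h5.congr_fun fun i ↦ ?_
    rw [one_mul, ← Real.exp_nat_mul, ← Real.exp_add]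
    congr 2
    ring
  · have := (summable_nat_add_iff 1).mpr (Real.summable_one_div_nat_rpow.mpr hs)
    simpa using this

/-- `1 / (e ^ x - 1)` with its singular part `1 / x` at the origin removed on `(0, 1]`. -/
noncomputable def expSubOneInvRegularized (x : ℝ) : ℂ :=
  ((1 / (rexp x - 1) : ℝ) : ℂ) - indicator (Ioc 0 1) (fun t : ℝ ↦ (t : ℂ) ^ (-1 : ℂ)) x

theorem continuousOn_one_div_exp_sub_one :
    ContinuousOn (fun t : ℝ ↦ ((1 / (rexp t - 1) : ℝ) : ℂ)) (Ioi 0) := by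
  refine Complex.continuous_ofReal.comp_continuousOn ?_
  exact ContinuousOn.div (by fun_prop) (by fun_prop) fun x hx ↦ (exp_sub_one_pos hx).ne'

theorem locallyIntegrableOn_one_div_exp_sub_one :
    LocallyIntegrableOn (fun t : ℝ ↦ ((1 / (rexp t - 1) : ℝ) : ℂ)) (Ioi 0) :=
  continuousOn_one_div_exp_sub_one.locallyIntegrableOn measurableSet_Ioi

theorem one_div_exp_sub_one_isBigO_atTop :
    (fun t : ℝ ↦ ((1 / (rexp t - 1) : ℝ) : ℂ)) =O[atTop] (fun t ↦ rexp (-1 * t)) := by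
  refine IsBigO.of_bound 2 ?_
  filter_upwards [eventually_ge_atTop 1] with t ht
  have h0 : 2 ≤ rexp t := by linarith [Real.add_one_le_exp t]
  have h1 : 0 < rexp t - 1 := by linarith
  rw [Complex.norm_real, Real.norm_of_nonneg (by positivity), Real.norm_of_nonneg (by positivity),
    neg_one_mul, Real.exp_neg, div_le_iff₀ h1]
  field_simp
  linarith

theorem mellinConvergent_one_div_exp_sub_one {s : ℂ} (hs : 1 < s.re) :
    MellinConvergent (fun t : ℝ ↦ ((1 / (rexp t - 1) : ℝ) : ℂ)) s := by
  refine mellinConvergent_of_isBigO_rpow_exp one_pos locallyIntegrableOn_one_div_exp_sub_one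
    one_div_exp_sub_one_isBigO_atTop (b := 1) ?_ hs
  refine IsBigO.of_bound 1 ?_
  filter_upwards [self_mem_nhdsWithin] with t ht
  have ht : 0 < t := ht
  have := exp_sub_one_pos ht
  rw [Complex.norm_real, Real.norm_of_nonneg (by positivity), Real.norm_of_nonneg (by positivity),
    Real.rpow_neg_one, one_mul, ← one_div t]
  exact one_div_exp_sub_one_le ht

theorem continuousOn_ofReal_cpow_neg_one :
    ContinuousOn (fun t : ℝ ↦ (t : ℂ) ^ (-1 : ℂ)) (Ioi 0) := fun _ ht ↦
  (Complex.continuousAt_ofReal_cpow_const _ _ (Or.inr (ne_of_gt ht))).continuousWithinAt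

theorem locallyIntegrableOn_expSubOneInvRegularized :
    LocallyIntegrableOn expSubOneInvRegularized (Ioi 0) := by
  refine locallyIntegrableOn_one_div_exp_sub_one.sub ?_
  have := continuousOn_ofReal_cpow_neg_one.locallyIntegrableOn (μ := volume) measurableSet_Ioi
  intro x hx
  obtain ⟨u, hu, hi⟩ := this x hx
  exact ⟨u, hu, hi.indicator measurableSet_Ioc⟩

theorem expSubOneInvRegularized_isBigO_atTop :
    expSubOneInvRegularized =O[atTop] (fun t ↦ rexp (-1 * t)) := by
  refine one_div_exp_sub_one_isBigO_atTop.congr' ?_ EventuallyEq.rfl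
  filter_upwards [eventually_gt_atTop 1] with t ht
  rw [expSubOneInvRegularized, indicator_of_notMem (fun h ↦ not_le.mpr ht h.2), sub_zero]

theorem expSubOneInvRegularized_isBigO_zero :
    expSubOneInvRegularized =O[𝓝[>] 0] (· ^ (-(0 : ℝ))) := by
  refine IsBigO.of_bound 1 ?_
  filter_upwards [Ioc_mem_nhdsGT one_pos] with t ht
  have := abs_expSubOneInvSubInv_le_one ht.1
  rw [expSubOneInvRegularized, indicator_of_mem ht, Complex.cpow_neg_one, ← Complex.ofReal_inv,
    ← Complex.ofReal_sub, Complex.norm_real, ← one_div t]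
  simpa [expSubOneInvSubInv] using this

theorem mellinConvergent_expSubOneInvRegularized {s : ℂ} (hs : 0 < s.re) :
    MellinConvergent expSubOneInvRegularized s :=
  mellinConvergent_of_isBigO_rpow_exp one_pos locallyIntegrableOn_expSubOneInvRegularized
    expSubOneInvRegularized_isBigO_atTop expSubOneInvRegularized_isBigO_zero hs

theorem differentiableAt_mellin_expSubOneInvRegularized {s : ℂ} (hs : 0 < s.re) :
    DifferentiableAt ℂ (mellin expSubOneInvRegularized) s :=
  mellin_differentiableAt_of_isBigO_rpow_exp one_pos locallyIntegrableOn_expSubOneInvRegularized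
    expSubOneInvRegularized_isBigO_atTop expSubOneInvRegularized_isBigO_zero hs

theorem mellin_expSubOneInvRegularized_of_one_lt_re {s : ℂ} (hs : 1 < s.re) :
    mellin expSubOneInvRegularized s = Complex.Gamma s * riemannZeta s - 1 / (s - 1) := by
  have h := hasMellin_cpow_Ioc (-1) (s := s) (by simpa using hs)
  have h2 := (hasMellin_sub (mellinConvergent_one_div_exp_sub_one hs) h.1).2
  rw [h.2, mellin_one_div_exp_sub_one hs, ← sub_eq_add_neg] at h2
  exact h2

theorem mul_riemannZeta_eq {s : ℂ} (h0 : 0 < s.re) (h1 : s ≠ 1) :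
    (s - 1) * riemannZeta s =
      ((s - 1) * completedRiemannZeta₀ s - (s - 1) / s + 1) * (Complex.Gammaℝ s)⁻¹ := by
  have h2 : s ≠ 0 := by rintro rfl; simp at h0
  have h3 : 1 - s ≠ 0 := sub_ne_zero.mpr h1.symm
  rw [riemannZeta_def_of_ne_zero h2, completedRiemannZeta_eq]
  have := Complex.Gammaℝ_ne_zero_of_re_pos h0
  field_simp
  ring

theorem mellin_expSubOneInvRegularized {s : ℂ} (h0 : 0 < s.re) (h1 : s ≠ 1) :
    mellin expSubOneInvRegularized s = Complex.Gamma s * riemannZeta s - 1 / (s - 1) := by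
  have hopen : IsOpen {z : ℂ | 0 < z.re} := isOpen_lt continuous_const Complex.continuous_re
  have hpre : IsPreconnected {z : ℂ | 0 < z.re} := (convex_halfSpace_re_gt 0).isPreconnected
  let G : ℂ → ℂ := fun z ↦ Complex.Gamma z *
    (((z - 1) * completedRiemannZeta₀ z - (z - 1) / z + 1) * (Complex.Gammaℝ z)⁻¹) - 1
  have hG (z : ℂ) (hz : 0 < z.re) (hz1 : z ≠ 1) :
      G z = (z - 1) * (Complex.Gamma z * riemannZeta z - 1 / (z - 1)) := by
    have := sub_ne_zero.mpr hz1
    simp only [G]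
    rw [← mul_riemannZeta_eq hz hz1]
    field_simp
  have hf : AnalyticOnNhd ℂ (fun z ↦ (z - 1) * mellin expSubOneInvRegularized z)
      {z : ℂ | 0 < z.re} := by
    refine DifferentiableOn.analyticOnNhd (fun z hz ↦ ?_) hopen
    have := differentiableAt_mellin_expSubOneInvRegularized (s := z) hz
    exact DifferentiableAt.differentiableWithinAt (by fun_prop)
  have hg : AnalyticOnNhd ℂ G {z : ℂ | 0 < z.re} := by
    refine DifferentiableOn.analyticOnNhd (fun z hz ↦ ?_) hopen
    have hz : 0 < z.re := hz
    have h2 : z ≠ 0 := by rintro rfl; simp at hz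
    have h3 : DifferentiableAt ℂ Complex.Gamma z := Complex.differentiableAt_Gamma z fun m hm ↦ by
      rw [hm] at hz
      simp at hz
      linarith [(Nat.cast_nonneg m : (0 : ℝ) ≤ m)]
    have h4 : DifferentiableAt ℂ completedRiemannZeta₀ z := differentiable_completedZeta₀ z
    have h5 : DifferentiableAt ℂ (fun z ↦ (Complex.Gammaℝ z)⁻¹) z :=
      Complex.differentiable_Gammaℝ_inv z
    refine DifferentiableAt.differentiableWithinAt ?_
    simp only [G]
    fun_prop (disch := assumption)
  have heq := hf.eqOn_of_preconnected_of_eventuallyEq hg hpre (z₀ := 2) (by simp) <| by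
    filter_upwards [(isOpen_lt continuous_const Complex.continuous_re).mem_nhds
      (show (2 : ℂ) ∈ {z : ℂ | 1 < z.re} by simp)] with z hz
    have hz : 1 < z.re := hz
    rw [hG z (by linarith) (by rintro rfl; simp at hz),
      mellin_expSubOneInvRegularized_of_one_lt_re hz]
  have := heq h0
  simp only [hG s h0 h1] at this
  exact mul_left_cancel₀ (sub_ne_zero.mpr h1) this

theorem hasMellin_inv_Ioi_one {s : ℂ} (hs : s.re < 1) :
    HasMellin (indicator (Ioi 1) (fun t : ℝ ↦ (t : ℂ) ^ (-1 : ℂ))) s (1 / (1 - s)) := by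
  have h1 : s ≠ 1 := by rintro rfl; simp at hs
  have hre : (s - 2).re < -1 := by simp; linarith
  have hcongr : EqOn (fun t : ℝ ↦ (t : ℂ) ^ (s - 1) • (t : ℂ) ^ (-1 : ℂ))
      (fun t : ℝ ↦ (t : ℂ) ^ (s - 2)) (Ioi 1) := fun t ht ↦ by
    have : (t : ℂ) ≠ 0 := Complex.ofReal_ne_zero.mpr (zero_lt_one.trans ht).ne'
    simp only [smul_eq_mul]
    rw [← Complex.cpow_add _ _ this]
    ring_nf
  have hsub : Ioi (1 : ℝ) ⊆ Ioi 0 := Ioi_subset_Ioi zero_le_one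
  simp_rw [HasMellin, mellin, MellinConvergent, ← indicator_smul, IntegrableOn,
    integrable_indicator_iff measurableSet_Ioi, integral_indicator measurableSet_Ioi, IntegrableOn,
    Measure.restrict_restrict_of_subset hsub]
  constructor
  · exact (integrableOn_Ioi_cpow_of_lt hre one_pos).congr_fun hcongr.symm measurableSet_Ioi
  · rw [setIntegral_congr_fun measurableSet_Ioi hcongr, integral_Ioi_cpow_of_lt hre one_pos]
    have h2 : s - 2 + 1 ≠ 0 := by
      intro h
      apply h1
      linear_combination h
    have h3 : 1 - s ≠ 0 := sub_ne_zero.mpr h1.symm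
    simp only [Complex.ofReal_one, Complex.one_cpow]
    field_simp
    ring

theorem hasMellin_expSubOneInvSubInv {s : ℂ} (h0 : 0 < s.re) (h1 : s.re < 1) :
    HasMellin (fun x ↦ (expSubOneInvSubInv x : ℂ)) s (Complex.Gamma s * riemannZeta s) := by
  have hs1 : s ≠ 1 := by rintro rfl; simp at h1
  have h2 := hasMellin_inv_Ioi_one h1
  have h := hasMellin_sub (mellinConvergent_expSubOneInvRegularized h0) h2.1
  have hcongr : EqOn (fun t : ℝ ↦ (t : ℂ) ^ (s - 1) • (expSubOneInvRegularized t -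
      indicator (Ioi 1) (fun t : ℝ ↦ (t : ℂ) ^ (-1 : ℂ)) t))
      (fun t : ℝ ↦ (t : ℂ) ^ (s - 1) • (expSubOneInvSubInv t : ℂ)) (Ioi 0) := fun t ht ↦ by
    have ht : 0 < t := ht
    simp only [expSubOneInvRegularized, expSubOneInvSubInv]
    rcases le_or_gt t 1 with h | h
    · rw [indicator_of_mem (s := Ioc 0 1) ⟨ht, h⟩,
        indicator_of_notMem (s := Ioi 1) (fun h' ↦ not_lt.mpr h h')]
      simp [Complex.cpow_neg_one]
    · rw [indicator_of_mem (s := Ioi 1) h,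
        indicator_of_notMem (s := Ioc 0 1) (fun h' ↦ not_le.mpr h h'.2)]
      simp [Complex.cpow_neg_one]
  refine ⟨IntegrableOn.congr_fun h.1 hcongr measurableSet_Ioi, ?_⟩
  rw [mellin, ← setIntegral_congr_fun measurableSet_Ioi hcongr]
  refine h.2.trans ?_
  rw [mellin_expSubOneInvRegularized h0 hs1, h2.2]
  have h3 : 1 - s ≠ 0 := sub_ne_zero.mpr hs1.symm
  have h4 : s - 1 ≠ 0 := sub_ne_zero.mpr hs1
  field_simp
  ring

theorem norm_fourier_le_integral_norm (F : ℝ → ℂ) (w : ℝ) : ‖𝓕 F w‖ ≤ ∫ v, ‖F v‖ :=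
  VectorFourier.norm_fourierIntegral_le_integral_norm 𝐞 _ (innerₗ ℝ) F w

theorem integrable_norm_fourier_sq {F : ℝ → ℂ} (hF : Integrable F) (hd : Differentiable ℝ F)
    (hF' : Integrable (deriv F)) : Integrable (fun w ↦ ‖𝓕 F w‖ ^ 2) := by
  have hcont : Continuous (𝓕 F) :=
    VectorFourier.fourierIntegral_continuous Real.continuous_fourierChar
      (by exact continuous_inner) hF
  refine (integrable_inv_one_add_sq.const_mul
    ((∫ v, ‖F v‖) ^ 2 + (∫ v, ‖deriv F v‖) ^ 2)).mono' (by fun_prop) (Eventually.of_forall fun w ↦ ?_)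
  have h0 := norm_fourier_le_integral_norm F w
  have h1 := norm_fourier_le_integral_norm (deriv F) w
  rw [Real.fourier_deriv hF hd hF', norm_smul] at h1
  have h2 : ‖(2 * π * Complex.I * w : ℂ)‖ = 2 * π * |w| := by
    simp [abs_of_pos pi_pos]
  rw [h2] at h1
  have h3 : |w| * ‖𝓕 F w‖ ≤ ∫ v, ‖deriv F v‖ := by
    refine le_trans ?_ h1
    gcongr
    nlinarith [abs_nonneg w, pi_gt_three]
  have h4 : (|w| * ‖𝓕 F w‖) ^ 2 ≤ (∫ v, ‖deriv F v‖) ^ 2 := by gcongr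
  have h5 : ‖𝓕 F w‖ ^ 2 ≤ (∫ v, ‖F v‖) ^ 2 := by gcongr
  rw [Real.norm_of_nonneg (by positivity), ← div_eq_mul_inv, le_div_iff₀ (by positivity)]
  rw [mul_pow, sq_abs] at h4
  linarith

theorem fourier_conj_comp_neg (F : ℝ → ℂ) (w : ℝ) :
    𝓕 (fun v ↦ conj (F (-v))) w = conj (𝓕 F w) := by
  rw [Real.fourier_eq', Real.fourier_eq', ← integral_conj, ← integral_neg_eq_self]
  congr 1 with v
  simp [← Complex.exp_conj, Complex.conj_ofNat]

theorem integral_mul_conj_sub_eq {F : ℝ → ℂ} (hF : Integrable F) (hc : Continuous F)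
    (hb : BddAbove (range fun v ↦ ‖F v‖)) (hsq : Integrable (fun w ↦ ‖𝓕 F w‖ ^ 2)) (m : ℝ) :
    ∫ v, F v * conj (F (v - m)) =
      ∫ w : ℝ, Complex.exp (2 * π * w * m * Complex.I) * ((‖𝓕 F w‖ ^ 2 : ℝ) : ℂ) := by
  set G : ℝ → ℂ := fun v ↦ conj (F (-v)) with hG
  have hGi : Integrable G := (Complex.conjLIE.integrable_comp_iff.mpr hF.comp_neg)
  have hGc : Continuous G := by fun_prop
  have hGb : BddAbove (range fun v ↦ ‖G v‖) := by
    obtain ⟨C, hC⟩ := hb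
    refine ⟨C, ?_⟩
    rintro _ ⟨v, rfl⟩
    simpa [hG] using hC ⟨-v, rfl⟩
  set H := F ⋆[ContinuousLinearMap.mul ℂ ℂ] G with hH
  have hHc : Continuous H := hGb.continuous_convolution_right_of_integrable _ hF hGc
  have hHi : Integrable H := hF.integrable_convolution _ hGi
  have hHF : 𝓕 H = fun w ↦ ((‖𝓕 F w‖ ^ 2 : ℝ) : ℂ) := by
    ext w
    rw [hH, Real.fourier_mul_convolution_eq hF hGi, hG, fourier_conj_comp_neg, Complex.mul_conj,
      Complex.normSq_eq_norm_sq]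
  have hinv := congrFun (hHc.fourierInv_fourier_eq hHi (by rw [hHF]; exact hsq.ofReal)) m
  have hHm : H m = ∫ v, F v * conj (F (v - m)) := by
    simp [hH, hG, convolution]
  rw [← hHm, ← hinv, hHF, Real.fourierInv_eq']
  refine integral_congr_ae (Eventually.of_forall fun w ↦ ?_)
  simp only [smul_eq_mul, RCLike.inner_apply, conj_trivial]
  congr 2
  push_cast
  ring

/-- The function `1 / (e ^ x - 1) - 1 / x` in the logarithmic variable `x = e ^ (-u)`, weighted
by `x ^ (1 / 2)`. -/
noncomputable def expSubOneInvSubInvLog (u : ℝ) : ℝ :=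
  rexp (-(1 / 2) * u) * expSubOneInvSubInv (rexp (-u))

theorem integrable_exp_neg_half_abs : Integrable (fun u : ℝ ↦ rexp (-(|u| / 2))) := by
  rw [← integrableOn_univ, ← Iic_union_Ioi (a := (0 : ℝ)), integrableOn_union]
  constructor
  · refine (integrableOn_exp_mul_Iic (a := 1 / 2) (by norm_num) 0).congr_fun (fun u hu ↦ ?_)
      measurableSet_Iic
    simp only [abs_of_nonpos (show u ≤ 0 from hu)]
    ring_nf
  · refine (integrableOn_exp_mul_Ioi (a := -(1 / 2)) (by norm_num) 0).congr_fun (fun u hu ↦ ?_)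
      measurableSet_Ioi
    simp only [abs_of_pos (show 0 < u from hu)]
    ring_nf

theorem exp_mul_le_exp_neg_half_abs {u y : ℝ} (h1 : y ≤ 1) (h2 : y ≤ 1 / rexp (-u)) :
    rexp (-(1 / 2) * u) * y ≤ rexp (-(|u| / 2)) := by
  rcases le_total 0 u with hu | hu
  · calc rexp (-(1 / 2) * u) * y ≤ rexp (-(1 / 2) * u) * 1 := by gcongr
      _ = rexp (-(|u| / 2)) := by rw [abs_of_nonneg hu]; ring_nf
  · calc rexp (-(1 / 2) * u) * y ≤ rexp (-(1 / 2) * u) * rexp u := by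
          gcongr
          rwa [one_div, ← Real.exp_neg, neg_neg] at h2
      _ = rexp (-(|u| / 2)) := by rw [abs_of_nonpos hu, ← Real.exp_add]; ring_nf

theorem abs_expSubOneInvSubInvLog_le (u : ℝ) :
    |expSubOneInvSubInvLog u| ≤ rexp (-(|u| / 2)) := by
  rw [expSubOneInvSubInvLog, abs_mul, Real.abs_exp]
  exact exp_mul_le_exp_neg_half_abs (abs_expSubOneInvSubInv_le_one (Real.exp_pos _))
    (abs_expSubOneInvSubInv_le_inv (Real.exp_pos _))

theorem hasDerivAt_expSubOneInvSubInv {x : ℝ} (hx : 0 < x) :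
    HasDerivAt expSubOneInvSubInv (1 / x ^ 2 - rexp x / (rexp x - 1) ^ 2) x := by
  have h1 := ((Real.hasDerivAt_exp x).sub_const 1).inv (exp_sub_one_pos hx).ne'
  have h2 := h1.sub (hasDerivAt_inv hx.ne')
  have h3 : expSubOneInvSubInv = (fun x ↦ rexp x - 1)⁻¹ - (fun x ↦ x⁻¹) := by
    ext y
    simp [expSubOneInvSubInv]
  rw [h3]
  refine h2.congr_deriv ?_
  ring

theorem exp_div_sq_le_one_div_sq {x : ℝ} (hx : 0 < x) :
    rexp x / (rexp x - 1) ^ 2 ≤ 1 / x ^ 2 := by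
  have h1 := exp_sub_one_pos hx
  have h2 : x / 2 ≤ Real.sinh (x / 2) := Real.self_le_sinh_iff.mpr (by positivity)
  rw [Real.sinh_eq] at h2
  have h3 : rexp x = rexp (x / 2) ^ 2 := by rw [← Real.exp_nat_mul]; ring_nf
  have h4 : rexp (x / 2) * rexp (-(x / 2)) = 1 := by rw [← Real.exp_add]; simp
  have h5 : x * rexp (x / 2) ≤ rexp x - 1 := by
    nlinarith [Real.exp_pos (x / 2)]
  have h6 : (x * rexp (x / 2)) ^ 2 ≤ (rexp x - 1) ^ 2 := by gcongr
  rw [div_le_div_iff₀ (by positivity) (by positivity)]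
  nlinarith

theorem one_div_sq_sub_exp_div_sq_le {x : ℝ} (hx : 0 < x) :
    1 / x ^ 2 - rexp x / (rexp x - 1) ^ 2 ≤ 1 / x := by
  have h1 := exp_sub_one_pos hx
  have h3 : 1 - x ≤ rexp (-x) := by linarith [Real.add_one_le_exp (-x)]
  have h4 : rexp x * rexp (-x) = 1 := by rw [← Real.exp_add]; simp
  have h5 : rexp x - 1 ≤ x * rexp x := by nlinarith [Real.exp_pos x]
  have h6 : (rexp x - 1) ^ 2 * (1 - x) ≤ x ^ 2 * rexp x := by
    calc (rexp x - 1) ^ 2 * (1 - x) ≤ (rexp x - 1) ^ 2 * rexp (-x) := by gcongr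
      _ ≤ (x * rexp x) ^ 2 * rexp (-x) := by gcongr
      _ = x ^ 2 * rexp x * (rexp x * rexp (-x)) := by ring
      _ = x ^ 2 * rexp x := by rw [h4, mul_one]
  have h7 : 1 / x ^ 2 - 1 / x = (1 - x) / x ^ 2 := by field_simp
  have h8 : (1 - x) / x ^ 2 ≤ rexp x / (rexp x - 1) ^ 2 := by
    rw [div_le_div_iff₀ (by positivity) (by positivity)]
    linarith
  linarith

theorem hasDerivAt_expSubOneInvSubInvLog (u : ℝ) :
    HasDerivAt expSubOneInvSubInvLog
      (rexp (-(1 / 2) * u) * (-(1 / 2) * expSubOneInvSubInv (rexp (-u)) -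
        rexp (-u) * (1 / rexp (-u) ^ 2 - rexp (rexp (-u)) / (rexp (rexp (-u)) - 1) ^ 2))) u := by
  have h1 : HasDerivAt (fun u : ℝ ↦ rexp (-(1 / 2) * u)) (rexp (-(1 / 2) * u) * -(1 / 2)) u := by
    simpa using ((hasDerivAt_id u).const_mul (-(1 / 2) : ℝ)).exp
  have h2 : HasDerivAt (fun u : ℝ ↦ rexp (-u)) (rexp (-u) * -1) u := (hasDerivAt_neg u).exp
  have h3 := h1.mul ((hasDerivAt_expSubOneInvSubInv (Real.exp_pos (-u))).comp u h2)
  refine h3.congr_deriv ?_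
  simp only [Function.comp_apply]
  ring

theorem abs_deriv_expSubOneInvSubInvLog_le (u : ℝ) :
    |deriv expSubOneInvSubInvLog u| ≤ 2 * rexp (-(|u| / 2)) := by
  rw [(hasDerivAt_expSubOneInvSubInvLog u).deriv]
  set x := rexp (-u) with hx
  have hx0 : 0 < x := Real.exp_pos _
  set d := 1 / x ^ 2 - rexp x / (rexp x - 1) ^ 2 with hd
  have hd0 : 0 ≤ d := sub_nonneg.mpr (exp_div_sq_le_one_div_sq hx0)
  have hd1 : x * d ≤ 1 := by
    calc x * d ≤ x * (1 / x) := by gcongr; exact one_div_sq_sub_exp_div_sq_le hx0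
      _ = 1 := by field_simp
  have hd2 : x * d ≤ 1 / x := by
    have : d ≤ 1 / x ^ 2 := sub_le_self _ (by positivity)
    calc x * d ≤ x * (1 / x ^ 2) := by gcongr
      _ = 1 / x := by field_simp
  have h1 := exp_mul_le_exp_neg_half_abs hd1 hd2
  have h2 := exp_mul_le_exp_neg_half_abs (abs_expSubOneInvSubInv_le_one hx0)
    (abs_expSubOneInvSubInv_le_inv hx0)
  have h3 : 0 < rexp (-(1 / 2) * u) := Real.exp_pos _
  have h4 : |-(1 / 2) * expSubOneInvSubInv x - x * d| ≤ |expSubOneInvSubInv x| + x * d := by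
    refine (abs_sub _ _).trans ?_
    rw [abs_mul, abs_of_nonneg (mul_nonneg hx0.le hd0)]
    have := abs_nonneg (expSubOneInvSubInv x)
    norm_num
    linarith
  rw [abs_mul, abs_of_pos h3]
  nlinarith [mul_le_mul_of_nonneg_left h4 h3.le]

theorem continuous_expSubOneInvSubInvLog : Continuous expSubOneInvSubInvLog :=
  continuous_iff_continuousAt.mpr fun u ↦ (hasDerivAt_expSubOneInvSubInvLog u).continuousAt

theorem integrable_expSubOneInvSubInvLog : Integrable expSubOneInvSubInvLog :=
  integrable_exp_neg_half_abs.mono' continuous_expSubOneInvSubInvLog.aestronglyMeasurable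
    (Eventually.of_forall abs_expSubOneInvSubInvLog_le)

theorem integrable_norm_fourier_expSubOneInvSubInvLog_sq :
    Integrable (fun w ↦ ‖𝓕 (fun u ↦ (expSubOneInvSubInvLog u : ℂ)) w‖ ^ 2) := by
  have hd (u : ℝ) : HasDerivAt (fun u ↦ (expSubOneInvSubInvLog u : ℂ))
      (deriv expSubOneInvSubInvLog u : ℝ) u :=
    ((hasDerivAt_expSubOneInvSubInvLog u).differentiableAt.hasDerivAt).ofReal_comp
  refine integrable_norm_fourier_sq integrable_expSubOneInvSubInvLog.ofReal
    (fun u ↦ (hd u).differentiableAt) ?_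
  rw [funext fun u ↦ (hd u).deriv]
  refine Integrable.ofReal ?_
  exact (integrable_exp_neg_half_abs.const_mul 2).mono'
    (measurable_deriv _).aestronglyMeasurable
    (Eventually.of_forall abs_deriv_expSubOneInvSubInvLog_le)

theorem fourier_expSubOneInvSubInvLog (w : ℝ) :
    𝓕 (fun u ↦ (expSubOneInvSubInvLog u : ℂ)) w =
      Complex.Gamma (1 / 2 + 2 * π * w * Complex.I) *
        riemannZeta (1 / 2 + 2 * π * w * Complex.I) := by
  have hre : (1 / 2 + 2 * π * w * Complex.I : ℂ).re = 1 / 2 := by simp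
  have him : (1 / 2 + 2 * π * w * Complex.I : ℂ).im = 2 * π * w := by simp
  rw [← (hasMellin_expSubOneInvSubInv (by rw [hre]; norm_num) (by rw [hre]; norm_num)).2,
    mellin_eq_fourier, hre, him]
  have h1 : 2 * π * w / (2 * π) = w := by field_simp
  rw [h1]
  refine congrArg (fun g : ℝ → ℂ ↦ 𝓕 g w) (funext fun u ↦ ?_)
  simp [expSubOneInvSubInvLog]

theorem setIntegral_Ioi_eq_integral_exp_neg (h : ℝ → ℂ) :
    ∫ x in Ioi (0 : ℝ), h x = ∫ u : ℝ, (rexp (-u) : ℂ) * h (rexp (-u)) := by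
  have h1 := mellin_eq_fourier h (s := 1)
  rw [mellin, Real.fourier_eq'] at h1
  simpa using h1

theorem integral_expSubOneInvSubInv_mul (n : ℝ) :
    ((∫ x in Ioi (0 : ℝ), expSubOneInvSubInv (x * rexp n) *
        expSubOneInvSubInv (x * rexp (-n)) : ℝ) : ℂ) =
      ∫ w : ℝ, Complex.exp (2 * π * w * (2 * n : ℝ) * Complex.I) *
        ((‖Complex.Gamma (1 / 2 + 2 * π * w * Complex.I) *
          riemannZeta (1 / 2 + 2 * π * w * Complex.I)‖ ^ 2 : ℝ) : ℂ) := by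
  have hb : BddAbove (range fun u ↦ ‖(expSubOneInvSubInvLog u : ℂ)‖) := by
    refine ⟨1, ?_⟩
    rintro _ ⟨u, rfl⟩
    simp only [Complex.norm_real, Real.norm_eq_abs]
    refine (abs_expSubOneInvSubInvLog_le u).trans (Real.exp_le_one_iff.mpr ?_)
    linarith [abs_nonneg u]
  have key := integral_mul_conj_sub_eq
    (F := fun u ↦ (expSubOneInvSubInvLog u : ℂ)) integrable_expSubOneInvSubInvLog.ofReal
    (Complex.continuous_ofReal.comp continuous_expSubOneInvSubInvLog) hb
    integrable_norm_fourier_expSubOneInvSubInvLog_sq (2 * n)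
  simp_rw [fourier_expSubOneInvSubInvLog] at key
  rw [← key, ← integral_complex_ofReal, setIntegral_Ioi_eq_integral_exp_neg,
    ← integral_add_right_eq_self _ (-n)]
  refine integral_congr_ae (Eventually.of_forall fun u ↦ ?_)
  simp only [Complex.conj_ofReal, expSubOneInvSubInvLog]
  norm_cast
  have e1 : rexp (-(u + -n)) * rexp n = rexp (-(u - 2 * n)) := by
    rw [← Real.exp_add]; ring_nf
  have e2 : rexp (-(u + -n)) * rexp (-n) = rexp (-u) := by
    rw [← Real.exp_add]; ring_nf
  have e3 : rexp (-(u + -n)) = rexp (-(1 / 2) * u) * rexp (-(1 / 2) * (u - 2 * n)) := by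
    rw [← Real.exp_add]; ring_nf
  rw [e1, e2, e3]
  ring

theorem norm_Gamma_sq_eq_of_re_eq_half {s : ℂ} (hs : conj s = 1 - s) :
    ‖Complex.Gamma s‖ ^ 2 = π / (2 * ‖Complex.sin (π * (s / 2))‖ ^ 2) := by
  have h1 : ‖Complex.Gamma (1 - s)‖ = ‖Complex.Gamma s‖ := by
    rw [← hs, Complex.Gamma_conj, Complex.norm_conj]
  have h2 := congrArg norm (Complex.Gamma_mul_Gamma_one_sub s)
  have h3 : Complex.cos (π * (s / 2)) = conj (Complex.sin (π * (s / 2))) := by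
    rw [← Complex.sin_conj, ← Complex.sin_pi_div_two_sub]
    congr 1
    simp only [map_mul, map_div₀, hs, Complex.conj_ofReal, Complex.conj_ofNat]
    ring
  have h4 : π * s = 2 * (π * (s / 2)) := by ring
  rw [norm_mul, h1, norm_div, h4, Complex.sin_two_mul, h3] at h2
  simp only [norm_mul, Complex.norm_conj, Complex.norm_real, Complex.norm_ofNat,
    Real.norm_of_nonneg pi_pos.le] at h2
  rw [sq, h2]
  ring_nf

theorem norm_Xi_mul_Gamma_sq_div (t : ℝ) :
    ‖Xi (t / 2) * Complex.Gamma ((-1 + Complex.I * t) / 4)‖ ^ 2 / (1 + t ^ 2) =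
      π ^ ((3 : ℝ) / 2) / (2 * π) * ‖Complex.Gamma (1 / 2 + t / 2 * Complex.I) *
        riemannZeta (1 / 2 + t / 2 * Complex.I)‖ ^ 2 := by
  set s : ℂ := 1 / 2 + t / 2 * Complex.I with hs
  have hconj : conj s = 1 - s := by
    simp only [hs, map_add, map_mul, map_div₀, map_one, Complex.conj_ofReal, Complex.conj_ofNat,
      Complex.conj_I]
    ring
  have hXi : Xi (t / 2) = xi s := by
    rw [Xi, hs]
    congr 1
    push_cast
    ring
  have hG : ‖Complex.Gamma ((-1 + Complex.I * t) / 4)‖ = ‖Complex.Gamma (-(s / 2))‖ := by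
    rw [← Complex.norm_conj, ← Complex.Gamma_conj]
    congr 2
    simp only [hs, map_add, map_mul, map_neg, map_div₀, map_one, Complex.conj_ofReal,
      Complex.conj_ofNat, Complex.conj_I]
    ring
  have hrefl : ‖Complex.Gamma (1 + s / 2)‖ * ‖Complex.Gamma (-(s / 2))‖ =
      π / ‖Complex.sin (π * (s / 2))‖ := by
    have h := congrArg norm (Complex.Gamma_mul_Gamma_one_sub (-(s / 2)))
    rw [sub_neg_eq_add, mul_neg, Complex.sin_neg, norm_mul, norm_div, norm_neg, Complex.norm_real,
      Real.norm_of_nonneg pi_pos.le] at h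
    rw [mul_comm, h]
  have hsub : ‖s - 1‖ ^ 2 = (1 + t ^ 2) / 4 := by
    rw [← Complex.normSq_eq_norm_sq, Complex.normSq_apply]
    simp [hs]
    ring
  have hpi : ‖(π : ℂ) ^ (-s / 2)‖ ^ 2 = π ^ (-(1 / 2) : ℝ) := by
    rw [Complex.norm_cpow_eq_rpow_re_of_pos pi_pos, ← Real.rpow_natCast, ← Real.rpow_mul pi_pos.le]
    congr 1
    simp [hs]
  have hpow : π ^ ((3 : ℝ) / 2) = π ^ (-(1 / 2) : ℝ) * π ^ 2 := by
    rw [← Real.rpow_natCast π 2, ← Real.rpow_add pi_pos]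
    norm_num
  have hsplit : ‖xi s * Complex.Gamma ((-1 + Complex.I * t) / 4)‖ ^ 2 =
      ‖s - 1‖ ^ 2 * ‖(π : ℂ) ^ (-s / 2)‖ ^ 2 *
        (‖Complex.Gamma (1 + s / 2)‖ * ‖Complex.Gamma (-(s / 2))‖) ^ 2 * ‖riemannZeta s‖ ^ 2 := by
    rw [xi, norm_mul, hG]
    simp only [norm_mul]
    ring
  rw [hXi, hsplit, hsub, hpi, hrefl, norm_mul, mul_pow, norm_Gamma_sq_eq_of_re_eq_half hconj, hpow]
  have h0 : (1 + t ^ 2) ≠ 0 := by positivity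
  have h1 := pi_pos.ne'
  field_simp
  ring

theorem norm_Gamma_mul_riemannZeta_abs (t : ℝ) :
    ‖Complex.Gamma (1 / 2 + (|t| : ℝ) / 2 * Complex.I) *
      riemannZeta (1 / 2 + (|t| : ℝ) / 2 * Complex.I)‖ =
    ‖Complex.Gamma (1 / 2 + t / 2 * Complex.I) * riemannZeta (1 / 2 + t / 2 * Complex.I)‖ := by
  rcases abs_choice t with h | h
  · rw [h]
  · rw [h, ← Complex.norm_conj, map_mul, ← Complex.Gamma_conj, ← riemannZeta_conj]
    simp [Complex.conj_ofNat, neg_div]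

theorem integral_expSubOneInvSubInv_mul_eq_integral_cos (n : ℝ) :
    ∫ x in Ioi (0 : ℝ), expSubOneInvSubInv (x * rexp n) * expSubOneInvSubInv (x * rexp (-n)) =
      (2 * π)⁻¹ * ∫ t in Ioi (0 : ℝ), ‖Complex.Gamma (1 / 2 + t / 2 * Complex.I) *
        riemannZeta (1 / 2 + t / 2 * Complex.I)‖ ^ 2 * Real.cos (n * t) := by
  set Φ : ℝ → ℝ := fun t ↦ ‖Complex.Gamma (1 / 2 + t / 2 * Complex.I) *
    riemannZeta (1 / 2 + t / 2 * Complex.I)‖ ^ 2 with hΦ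
  have hΦw (w : ℝ) : ‖Complex.Gamma (1 / 2 + 2 * π * w * Complex.I) *
      riemannZeta (1 / 2 + 2 * π * w * Complex.I)‖ ^ 2 = Φ (4 * π * w) := by
    simp only [hΦ]
    push_cast
    ring_nf
  have hint : Integrable fun w : ℝ ↦ Φ (4 * π * w) := by
    simpa only [fourier_expSubOneInvSubInvLog, hΦw] using
      integrable_norm_fourier_expSubOneInvSubInvLog_sq
  have hexp (w : ℝ) : Complex.exp (2 * π * w * (2 * n : ℝ) * Complex.I) =
      Complex.exp ((n * (4 * π * w) : ℝ) * Complex.I) := by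
    push_cast
    ring_nf
  have key := integral_expSubOneInvSubInv_mul n
  simp only [hΦw, hexp] at key
  have hint' : Integrable fun w : ℝ ↦ Complex.exp ((n * (4 * π * w) : ℝ) * Complex.I) *
      (Φ (4 * π * w) : ℂ) := by
    refine hint.ofReal.bdd_mul (c := 1) (by fun_prop) (Eventually.of_forall fun w ↦ ?_)
    rw [Complex.norm_exp_ofReal_mul_I]
  have hre := congrArg Complex.re key
  rw [Complex.ofReal_re, ← RCLike.re_eq_complex_re, ← integral_re hint'] at hre
  rw [hre]
  have hpt (w : ℝ) : RCLike.re (Complex.exp ((n * (4 * π * w) : ℝ) * Complex.I) *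
      (Φ (4 * π * w) : ℂ)) = (fun t ↦ Φ t * Real.cos (n * t)) (4 * π * w) := by
    rw [RCLike.re_eq_complex_re, Complex.re_mul_ofReal, Complex.exp_ofReal_mul_I_re, mul_comm]
  simp_rw [hpt]
  rw [Measure.integral_comp_mul_left (fun t ↦ Φ t * Real.cos (n * t))]
  have heven (t : ℝ) : Φ t * Real.cos (n * t) = (fun t ↦ Φ t * Real.cos (n * t)) |t| := by
    have h1 : Real.cos (n * |t|) = Real.cos (n * t) := by
      rcases abs_choice t with h | h <;> simp [h]
    simp only [hΦ, h1, norm_Gamma_mul_riemannZeta_abs]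
  rw [integral_congr_ae (Eventually.of_forall heven),
    integral_comp_abs (f := fun t ↦ Φ t * Real.cos (n * t)), smul_eq_mul,
    abs_of_pos (by positivity)]
  change _ = (2 * π)⁻¹ * ∫ t in Ioi (0 : ℝ), Φ t * Real.cos (n * t)
  generalize ∫ t in Ioi (0 : ℝ), Φ t * Real.cos (n * t) = J
  field_simp
  ring

theorem ramanujan_Xi_integral (n : ℝ) :
    ∫ t in Set.Ioi (0 : ℝ),
        ‖Xi (t / 2) * Complex.Gamma ((-1 + Complex.I * t) / 4)‖ ^ 2 *
          Real.cos (n * t) / (1 + t ^ 2)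
      = π ^ ((3 : ℝ) / 2) *
          ∫ x in Set.Ioi (0 : ℝ),
            (1 / (Real.exp (x * Real.exp n) - 1) - 1 / (x * Real.exp n)) *
              (1 / (Real.exp (x * Real.exp (-n)) - 1) - 1 / (x * Real.exp (-n))) := by
  have h := integral_expSubOneInvSubInv_mul_eq_integral_cos n
  simp only [expSubOneInvSubInv] at h
  rw [h, ← mul_assoc, ← integral_const_mul]
  refine integral_congr_ae (Eventually.of_forall fun t ↦ ?_)
  simp only
  rw [mul_div_right_comm, norm_Xi_mul_Gamma_sq_div]
  ring
end
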